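/- arXiv:2411.09274 — 5 statements merged into one kernel-verified Lean document; each statement's English description precedes it below -/
import Mathlib

section
/- Liouville theorem for sums of p-Laplace type operators with exponents at least the dimension: let n ≥ 1, N ≥ 1, real exponents n ≤ p₁ ≤ ⋯ ≤ p_N, let a_i : ℝⁿ × ℝ → ℝ (i = 1,…,N) satisfy λ ≤ a_i(x,s) ≤ Λ for a.e. x ∈ ℝⁿ and all s ∈ ℝ, where 0 < λ ≤ Λ, and let b : ℝⁿ × ℝ → ℝ be bounded with b(x,s)·s ≥ 0 for a.e. x ∈ ℝⁿ and all s ∈ ℝ. If u : ℝⁿ → ℝ is a bounded solution of -∂_{x_k}(∑_{i=1}^N a_i(x,u)|∇u|^{p_i−2} ∂_{x_k} u) + b(x,u) = 0 in ℝⁿ, then u is constant. -/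
open MeasureTheory Metric
open scoped RealInnerProductSpace

open Filter Topology Convolution

/-- Averaging against a normed bump function does not increase a uniform bound. -/
lemma norm_normed_convolution_le {E : Type*} [NormedAddCommGroup E] [InnerProductSpace ℝ E]
    [FiniteDimensional ℝ E] [MeasurableSpace E] [BorelSpace E]
    {F : Type*} [NormedAddCommGroup F] [NormedSpace ℝ F]
    (φ : ContDiffBump (0 : E)) {f : E → F} {D : ℝ} (hD : ∀ x, ‖f x‖ ≤ D) (x : E) :
    ‖(φ.normed volume ⋆[ContinuousLinearMap.lsmul ℝ ℝ, volume] f) x‖ ≤ D := by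
  rw [convolution_def]
  refine (norm_integral_le_of_norm_le (g := fun t => φ.normed volume t * D)
    (φ.integrable_normed.mul_const D) (ae_of_all _ fun t => ?_)).trans_eq ?_
  · simp only [ContinuousLinearMap.lsmul_apply, norm_smul, Real.norm_eq_abs]
    rw [abs_of_nonneg (φ.nonneg_normed t)]
    exact mul_le_mul_of_nonneg_left (hD _) (φ.nonneg_normed t)
  · rw [integral_mul_const, φ.integral_normed, one_mul]

/-- A compactly supported `C¹` function is the pointwise limit, together with its derivative, of
smooth functions that are bounded in `C¹` and supported in a common compact set. -/
lemma exists_smooth_approximation {E : Type*} [NormedAddCommGroup E] [InnerProductSpace ℝ E]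
    [FiniteDimensional ℝ E] [MeasurableSpace E] [BorelSpace E]
    {v : E → ℝ} (hv : ContDiff ℝ 1 v) (hc : HasCompactSupport v) :
    ∃ (w : ℕ → E → ℝ) (K : Set E) (C : ℝ), IsCompact K ∧
      (∀ k, ContDiff ℝ (⊤ : ℕ∞) (w k)) ∧ (∀ k, tsupport (w k) ⊆ K) ∧
      (∀ k x, |w k x| ≤ C) ∧ (∀ k x, ‖fderiv ℝ (w k) x‖ ≤ C) ∧
      (∀ x, Tendsto (fun k => w k x) atTop (𝓝 (v x))) ∧
      (∀ x, Tendsto (fun k => fderiv ℝ (w k) x) atTop (𝓝 (fderiv ℝ v x))) := by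
  let φ : ℕ → ContDiffBump (0 : E) := fun k =>
    ⟨1 / (2 * ((k : ℝ) + 1)), 1 / ((k : ℝ) + 1), by positivity, by
      apply one_div_lt_one_div_of_lt <;> nlinarith [(k.cast_nonneg : (0 : ℝ) ≤ k)]⟩
  have hφ : Tendsto (fun k => (φ k).rOut) atTop (𝓝 0) := tendsto_one_div_add_atTop_nhds_zero_nat
  have hφ1 : ∀ k, (φ k).rOut ≤ 1 := fun k => by
    change 1 / ((k : ℝ) + 1) ≤ 1
    rw [div_le_one (by positivity)]
    linarith [(k.cast_nonneg : (0 : ℝ) ≤ k)]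
  have hφli : ∀ k, LocallyIntegrable ((φ k).normed volume) (volume : Measure E) := fun k =>
    (φ k).continuous_normed.locallyIntegrable
  have hv' : Continuous (fderiv ℝ v) := hv.continuous_fderiv one_ne_zero
  obtain ⟨C₁, hC₁⟩ := hv.continuous.bounded_above_of_compact_support hc
  obtain ⟨C₂, hC₂⟩ := hv'.bounded_above_of_compact_support (hc.fderiv (𝕜 := ℝ))
  have hfd : ∀ k x, fderiv ℝ ((φ k).normed volume ⋆[ContinuousLinearMap.lsmul ℝ ℝ, volume] v) x
      = ((φ k).normed volume ⋆[ContinuousLinearMap.lsmul ℝ ℝ, volume] fderiv ℝ v) x := by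
    intro k x
    rw [(hc.hasFDerivAt_convolution_right (ContinuousLinearMap.lsmul ℝ ℝ) (hφli k) hv x).fderiv]
    rfl
  refine ⟨fun k => (φ k).normed volume ⋆[ContinuousLinearMap.lsmul ℝ ℝ, volume] v,
    cthickening 1 (tsupport v), max C₁ C₂, hc.isCompact.cthickening, ?_, ?_, ?_, ?_, ?_, ?_⟩
  · intro k
    exact (φ k).hasCompactSupport_normed.contDiff_convolution_left _ (φ k).contDiff_normed
      hv.continuous.locallyIntegrable
  · intro k
    refine closure_minimal ?_ isClosed_cthickening
    refine (support_convolution_subset _).trans ?_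
    rintro _ ⟨y, hy, z, hz, rfl⟩
    rw [(φ k).support_normed_eq, mem_ball_zero_iff] at hy
    refine mem_cthickening_of_dist_le _ z _ _ (subset_tsupport v hz) ?_
    simpa [dist_eq_norm] using hy.le.trans (hφ1 k)
  · exact fun k x => (norm_normed_convolution_le (φ k) hC₁ x).trans (le_max_left _ _)
  · intro k x
    rw [hfd]
    exact (norm_normed_convolution_le (φ k) hC₂ x).trans (le_max_right _ _)
  · intro x
    exact ContDiffBump.convolution_tendsto_right_of_continuous hφ hv.continuous x
  · intro x
    simp_rw [hfd]
    exact ContDiffBump.convolution_tendsto_right_of_continuous hφ hv' x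

/-- A weak equation `-div V + β = 0` tested by smooth functions may be tested by `C¹` functions. -/
lemma integral_fderiv_add_integral_eq_zero_of_smooth {E : Type*} [NormedAddCommGroup E]
    [InnerProductSpace ℝ E] [FiniteDimensional ℝ E] [MeasurableSpace E] [BorelSpace E]
    {V : E → E} {β : E → ℝ} (hV : LocallyIntegrable V) (hβ : LocallyIntegrable β)
    (h : ∀ v : E → ℝ, ContDiff ℝ (⊤ : ℕ∞) v → HasCompactSupport v →
      (∫ x, fderiv ℝ v x (V x)) + ∫ x, β x * v x = 0)
    {v : E → ℝ} (hv : ContDiff ℝ 1 v) (hc : HasCompactSupport v) :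
    (∫ x, fderiv ℝ v x (V x)) + ∫ x, β x * v x = 0 := by
  obtain ⟨w, K, C, hK, hw, hwK, hwC, hwC', hlim, hlim'⟩ := exists_smooth_approximation hv hc
  have hzero : ∀ k x, x ∉ K → w k x = 0 := fun k x hx =>
    image_eq_zero_of_notMem_tsupport fun h => hx (hwK k h)
  have hzero' : ∀ k x, x ∉ K → fderiv ℝ (w k) x = 0 := fun k x hx =>
    fderiv_of_notMem_tsupport ℝ fun h => hx (hwK k h)
  have hVK : Integrable (K.indicator fun x => C * ‖V x‖) :=
    (integrable_indicator_iff hK.measurableSet).2 ((hV.integrableOn_isCompact hK).norm.const_mul C)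
  have hβK : Integrable (K.indicator fun x => ‖β x‖ * C) :=
    (integrable_indicator_iff hK.measurableSet).2 ((hβ.integrableOn_isCompact hK).norm.mul_const C)
  have h1 : Tendsto (fun k => ∫ x, fderiv ℝ (w k) x (V x)) atTop
      (𝓝 (∫ x, fderiv ℝ v x (V x))) := by
    refine tendsto_integral_of_dominated_convergence _ (fun k => ?_) hVK
      (fun k => ae_of_all _ fun x => ?_) (ae_of_all _ fun x => ?_)
    · exact isBoundedBilinearMap_apply.continuous.comp_aestronglyMeasurable
        (((hw k).continuous_fderiv (by simp)).aestronglyMeasurable.prodMk hV.aestronglyMeasurable)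
    · by_cases hx : x ∈ K
      · rw [Set.indicator_of_mem hx]
        exact ((fderiv ℝ (w k) x).le_opNorm _).trans
          (mul_le_mul_of_nonneg_right (hwC' k x) (norm_nonneg _))
      · simp [hzero' k x hx, Set.indicator_of_notMem hx]
    · exact ((ContinuousLinearMap.apply ℝ ℝ (V x)).continuous.tendsto _).comp (hlim' x)
  have h2 : Tendsto (fun k => ∫ x, β x * w k x) atTop (𝓝 (∫ x, β x * v x)) := by
    refine tendsto_integral_of_dominated_convergence _ (fun k => ?_) hβK
      (fun k => ae_of_all _ fun x => ?_) (ae_of_all _ fun x => (hlim x).const_mul _)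
    · exact hβ.aestronglyMeasurable.mul (hw k).continuous.aestronglyMeasurable
    · by_cases hx : x ∈ K
      · rw [Set.indicator_of_mem hx, norm_mul]
        exact mul_le_mul_of_nonneg_left (hwC k x) (norm_nonneg _)
      · simp [hzero k x hx, Set.indicator_of_notMem hx]
  refine tendsto_nhds_unique (h1.add h2) ?_
  simp_rw [fun k => h (w k) (hw k) (hK.of_isClosed_subset (isClosed_tsupport _) (hwK k))]
  exact tendsto_const_nhds

/-- A Young type inequality with parameter `δ`, weighted by powers of a cutoff value `h`. -/
lemma rpow_sub_one_mul_pow_mul_le {s h t p δ : ℝ} {q : ℕ} (hs : 0 ≤ s) (hh0 : 0 ≤ h)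
    (hh1 : h ≤ 1) (ht : 0 ≤ t) (hp : 1 < p) (hq : p ≤ q) (hδ : 0 < δ) :
    s ^ (p - 1) * h ^ (q - 1) * t ≤ δ * (s ^ p * h ^ q) + δ ^ (1 - p) * t ^ p := by
  have hq1 : 1 ≤ q := by
    have : (1 : ℝ) < q := hp.trans_le hq
    exact_mod_cast this.le
  have hp0 : 0 < p - 1 := by linarith
  have hsp : s ^ p = s ^ (p - 1) * s := by
    rw [← Real.rpow_add_one' hs (by linarith)]
    congr 1
    ring
  rcases le_total t (δ * (s * h)) with hle | hle
  · have h1 : s ^ (p - 1) * h ^ (q - 1) * t ≤ s ^ (p - 1) * h ^ (q - 1) * (δ * (s * h)) := by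
      gcongr
    have h2 : h ^ q = h ^ (q - 1) * h := by rw [← pow_succ, Nat.sub_add_cancel hq1]
    have h3 : 0 ≤ δ ^ (1 - p) * t ^ p := by positivity
    rw [hsp, h2]
    linarith [h1, h3]
  · have h1 : h ^ (q - 1) ≤ h ^ (p - 1) := by
      rcases hh0.eq_or_lt with rfl | hpos
      · rw [Real.zero_rpow hp0.ne', zero_pow]
        have : (1 : ℝ) < q := hp.trans_le hq
        have : 1 < q := by exact_mod_cast this
        omega
      · rw [← Real.rpow_natCast h (q - 1)]
        refine Real.rpow_le_rpow_of_exponent_ge hpos hh1 ?_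
        rw [Nat.cast_sub hq1]
        simpa using hq
    have h2 : s * h ≤ t / δ := by rwa [le_div_iff₀' hδ]
    have h3 : s ^ (p - 1) * h ^ (p - 1) ≤ (t / δ) ^ (p - 1) := by
      rw [← Real.mul_rpow hs hh0]
      exact Real.rpow_le_rpow (by positivity) h2 hp0.le
    have h4 : (t / δ) ^ (p - 1) * t = δ ^ (1 - p) * t ^ p := by
      rw [Real.div_rpow ht hδ.le, show 1 - p = -(p - 1) by ring, Real.rpow_neg hδ.le,
        show t ^ p = t ^ (p - 1) * t by
          rw [← Real.rpow_add_one' ht (by linarith)]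
          congr 1
          ring]
      ring
    have h5 : 0 ≤ δ * (s ^ p * h ^ q) := by positivity
    calc s ^ (p - 1) * h ^ (q - 1) * t ≤ s ^ (p - 1) * h ^ (p - 1) * t := by gcongr
      _ ≤ (t / δ) ^ (p - 1) * t := by gcongr
      _ = δ ^ (1 - p) * t ^ p := h4
      _ ≤ _ := by linarith

/-- Cutoff functions equal to `1` on `ball 0 R`, whose gradients have `L^p` norm bounded
independently of `R` for every `p` at least the dimension. -/
lemma exists_scaled_cutoff (E : Type*) [NormedAddCommGroup E] [InnerProductSpace ℝ E]
    [FiniteDimensional ℝ E] [MeasurableSpace E] [BorelSpace E] :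
    ∃ C : ℝ → ℝ, ∀ R : ℝ, 1 ≤ R → ∃ η : E → ℝ, ContDiff ℝ 1 η ∧ HasCompactSupport η ∧
      (∀ x, 0 ≤ η x) ∧ (∀ x, η x ≤ 1) ∧ (∀ x ∈ ball 0 R, η x = 1) ∧
      (∀ x ∈ ball 0 R, fderiv ℝ η x = 0) ∧
      ∀ p : ℝ, (Module.finrank ℝ E : ℝ) ≤ p → ∫ x, ‖fderiv ℝ η x‖ ^ p ≤ C p := by
  let φ : ContDiffBump (0 : E) := ⟨1, 2, one_pos, one_lt_two⟩
  refine ⟨fun p => ∫ x, ‖fderiv ℝ φ x‖ ^ p, fun R hR => ?_⟩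
  have hR0 : 0 < R := one_pos.trans_le hR
  have hone : ∀ x ∈ ball (0 : E) R, φ (R⁻¹ • x) = 1 := by
    intro x hx
    refine φ.one_of_mem_closedBall ?_
    rw [mem_ball_zero_iff] at hx
    rw [mem_closedBall_zero_iff, norm_smul, norm_inv, Real.norm_of_nonneg hR0.le,
      inv_mul_le_iff₀ hR0]
    simpa [φ] using hx.le
  have hder : ∀ x, fderiv ℝ (fun x => φ (R⁻¹ • x)) x = R⁻¹ • fderiv ℝ φ (R⁻¹ • x) := by
    intro x
    exact fderiv_comp_smul _
  refine ⟨fun x => φ (R⁻¹ • x), φ.contDiff.comp (contDiff_const_smul _),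
    φ.hasCompactSupport.comp_smul (inv_ne_zero hR0.ne'), fun x => φ.nonneg, fun x => φ.le_one,
    hone, fun x hx => ?_, fun p hp => ?_⟩
  · have : (fun x => φ (R⁻¹ • x)) =ᶠ[𝓝 x] fun _ => 1 := by
      filter_upwards [isOpen_ball.mem_nhds hx] with y hy using hone y hy
    rw [this.fderiv_eq]
    simp
  · simp_rw [hder, norm_smul, norm_inv, Real.norm_of_nonneg hR0.le,
      Real.mul_rpow (inv_nonneg.2 hR0.le) (norm_nonneg _)]
    rw [integral_const_mul,
      Measure.integral_comp_inv_smul_of_nonneg volume (fun x => ‖fderiv ℝ φ x‖ ^ p) hR0.le,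
      smul_eq_mul, ← mul_assoc]
    refine mul_le_of_le_one_left (integral_nonneg fun x => by positivity) ?_
    rw [Real.inv_rpow hR0.le, inv_mul_le_iff₀ (by positivity), mul_one, ← Real.rpow_natCast]
    exact Real.rpow_le_rpow_of_exponent_le hR hp

/-- Caccioppoli type inequality: the energy of `u`, weighted by a power of a cutoff `η`, is
controlled by its energy on a set containing the support of `∇η` and by the norms of `∇η`. -/
lemma energy_inequality {E : Type*} [NormedAddCommGroup E] [InnerProductSpace ℝ E]
    [FiniteDimensional ℝ E] [MeasurableSpace E] [BorelSpace E] {ι : Type*} [Fintype ι]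
    {p : ι → ℝ} (hp : ∀ i, 1 < p i) {lam Lam M : ℝ} (hLam : 0 ≤ Lam) (hM : 0 ≤ M)
    {V : E → E} {β : E → ℝ} (hV : LocallyIntegrable V)
    {u : E → ℝ} (hu : ContDiff ℝ 1 u) (huM : ∀ x, |u x| ≤ M)
    (hlow : ∀ᵐ x, lam * ∑ i, ‖fderiv ℝ u x‖ ^ p i ≤ fderiv ℝ u x (V x))
    (hup : ∀ᵐ x, ‖V x‖ ≤ Lam * ∑ i, ‖fderiv ℝ u x‖ ^ (p i - 1))
    (hβu : ∀ᵐ x, 0 ≤ β x * u x)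
    (hsol : ∀ v : E → ℝ, ContDiff ℝ 1 v → HasCompactSupport v →
      (∫ x, fderiv ℝ v x (V x)) + ∫ x, β x * v x = 0)
    {q : ℕ} (hq : ∀ i, p i ≤ q) (hq0 : q ≠ 0) {η : E → ℝ} (hη : ContDiff ℝ 1 η)
    (hηc : HasCompactSupport η) (hη0 : ∀ x, 0 ≤ η x) (hη1 : ∀ x, η x ≤ 1)
    {S : Set E} (hS : MeasurableSet S) (hηS : ∀ x, x ∉ S → fderiv ℝ η x = 0)
    {δ : ℝ} (hδ : 0 < δ) :
    lam * ∫ x, (∑ i, ‖fderiv ℝ u x‖ ^ p i) * η x ^ q ≤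
      M * q * Lam * (δ * (∫ x in S, (∑ i, ‖fderiv ℝ u x‖ ^ p i) * η x ^ q) +
        ∑ i, δ ^ (1 - p i) * ∫ x, ‖fderiv ℝ η x‖ ^ p i) := by
  set F : E → ℝ := fun x => ∑ i, ‖fderiv ℝ u x‖ ^ p i with hF
  have hDu : Continuous (fderiv ℝ u) := hu.continuous_fderiv one_ne_zero
  have hDη : Continuous (fderiv ℝ η) := hη.continuous_fderiv one_ne_zero
  have hFc : Continuous F := continuous_finsetSum _ fun i _ =>
    hDu.norm.rpow_const fun x => Or.inr (by linarith [hp i])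
  have hF0 : ∀ x, 0 ≤ F x := fun x => Finset.sum_nonneg fun i _ => by positivity
  have hηq : HasCompactSupport fun x => η x ^ q := hηc.comp_left (g := fun y => y ^ q) (by simp [hq0])
  have hv : ContDiff ℝ 1 fun x => u x * η x ^ q := hu.mul (hη.pow q)
  have hvc : HasCompactSupport fun x => u x * η x ^ q := hηq.mul_left
  have hFη : Integrable fun x => F x * η x ^ q :=
    (hFc.mul (hη.continuous.pow q)).integrable_of_hasCompactSupport hηq.mul_left
  have hDηp : ∀ i, Integrable fun x => ‖fderiv ℝ η x‖ ^ p i := fun i => by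
    refine (hDη.norm.rpow_const fun x => Or.inr (by linarith [hp i])).integrable_of_hasCompactSupport
      ((hηc.fderiv (𝕜 := ℝ)).comp_left (g := fun y => ‖y‖ ^ p i) ?_)
    simp [Real.zero_rpow (by linarith [hp i] : p i ≠ 0)]
  have hderiv : ∀ x, fderiv ℝ (fun x => u x * η x ^ q) x (V x) =
      η x ^ q * fderiv ℝ u x (V x) + u x * (q * η x ^ (q - 1) * fderiv ℝ η x (V x)) := by
    intro x
    have h1 := ((hu.differentiable one_ne_zero x).hasFDerivAt).mul
      (((hη.differentiable one_ne_zero x).hasFDerivAt).pow q)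
    have h2 : fderiv ℝ (fun x => u x * η x ^ q) x = _ := h1.fderiv
    rw [h2]
    simp
    ring
  have hDv : Integrable fun x => fderiv ℝ (fun x => u x * η x ^ q) x (V x) := by
    have hDvc : Continuous (fderiv ℝ fun x => u x * η x ^ q) := hv.continuous_fderiv one_ne_zero
    have hK : IsCompact (tsupport fun x => u x * η x ^ q) := hvc
    obtain ⟨C, hC⟩ := hDvc.bounded_above_of_compact_support (hvc.fderiv (𝕜 := ℝ))
    refine Integrable.mono' ((integrable_indicator_iff hK.measurableSet).2
      ((hV.integrableOn_isCompact hK).norm.const_mul C))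
      (isBoundedBilinearMap_apply.continuous.comp_aestronglyMeasurable
        (hDvc.aestronglyMeasurable.prodMk hV.aestronglyMeasurable)) (ae_of_all _ fun x => ?_)
    by_cases hx : x ∈ tsupport fun x => u x * η x ^ q
    · rw [Set.indicator_of_mem hx]
      exact (ContinuousLinearMap.le_opNorm _ _).trans
        (mul_le_mul_of_nonneg_right (hC x) (norm_nonneg _))
    · simp only [Set.indicator_of_notMem hx, fderiv_of_notMem_tsupport ℝ hx]
      simp
  have hDv_le : ∫ x, fderiv ℝ (fun x => u x * η x ^ q) x (V x) ≤ 0 := by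
    have h1 := hsol _ hv hvc
    have h2 : 0 ≤ ∫ x, β x * (u x * η x ^ q) := by
      refine integral_nonneg_of_ae ?_
      filter_upwards [hβu] with x hx
      change 0 ≤ β x * (u x * η x ^ q)
      rw [← mul_assoc]
      exact mul_nonneg hx (pow_nonneg (hη0 x) q)
    linarith
  have hpt : ∀ᵐ x, lam * (F x * η x ^ q) ≤ fderiv ℝ (fun x => u x * η x ^ q) x (V x) +
      M * q * Lam * (δ * S.indicator (fun x => F x * η x ^ q) x +
        ∑ i, δ ^ (1 - p i) * ‖fderiv ℝ η x‖ ^ p i) := by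
    filter_upwards [hlow, hup] with x hl hu'
    have hηx := hη0 x
    have hprod : ‖V x‖ * η x ^ (q - 1) * ‖fderiv ℝ η x‖ ≤
        Lam * (δ * S.indicator (fun x => F x * η x ^ q) x +
        ∑ i, δ ^ (1 - p i) * ‖fderiv ℝ η x‖ ^ p i) := by
      by_cases hx : x ∈ S
      · rw [Set.indicator_of_mem hx, hF]
        calc ‖V x‖ * η x ^ (q - 1) * ‖fderiv ℝ η x‖
            ≤ (Lam * ∑ i, ‖fderiv ℝ u x‖ ^ (p i - 1)) * η x ^ (q - 1) * ‖fderiv ℝ η x‖ := by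
              gcongr
          _ = Lam * ∑ i, ‖fderiv ℝ u x‖ ^ (p i - 1) * η x ^ (q - 1) * ‖fderiv ℝ η x‖ := by
              rw [mul_assoc, mul_assoc, Finset.sum_mul]
              simp_rw [mul_assoc]
          _ ≤ Lam * ∑ i, (δ * (‖fderiv ℝ u x‖ ^ p i * η x ^ q) +
                δ ^ (1 - p i) * ‖fderiv ℝ η x‖ ^ p i) := by
              gcongr with i
              exact rpow_sub_one_mul_pow_mul_le (norm_nonneg _) hηx (hη1 x) (norm_nonneg _)
                (hp i) (hq i) hδ
          _ = _ := by
              rw [Finset.sum_add_distrib, ← Finset.mul_sum, ← Finset.sum_mul]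
      · rw [Set.indicator_of_notMem hx, hηS x hx]
        simp only [norm_zero, mul_zero, zero_add]
        exact mul_nonneg hLam (Finset.sum_nonneg fun i _ => by positivity)
    have hcross : -(u x * (q * η x ^ (q - 1) * fderiv ℝ η x (V x))) ≤
        M * q * (‖V x‖ * η x ^ (q - 1) * ‖fderiv ℝ η x‖) := by
      refine (neg_le_abs _).trans ?_
      rw [abs_mul, abs_mul, abs_of_nonneg (by positivity : (0 : ℝ) ≤ q * η x ^ (q - 1))]
      calc |u x| * (q * η x ^ (q - 1) * |fderiv ℝ η x (V x)|)
          ≤ M * (q * η x ^ (q - 1) * (‖fderiv ℝ η x‖ * ‖V x‖)) := by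
            gcongr
            · exact huM x
            · exact (fderiv ℝ η x).le_opNorm (V x)
        _ = _ := by ring
    have hmain : lam * (F x * η x ^ q) ≤ η x ^ q * fderiv ℝ u x (V x) := by
      have := mul_le_mul_of_nonneg_right hl (pow_nonneg hηx q)
      simp only [hF]
      linarith
    have hscaled := mul_le_mul_of_nonneg_left hprod (by positivity : 0 ≤ M * q)
    rw [hderiv]
    linarith
  have hFS_int : Integrable fun x => δ * S.indicator (fun x => F x * η x ^ q) x :=
    (hFη.indicator hS).const_mul δ
  have hDη_int : Integrable fun x => ∑ i, δ ^ (1 - p i) * ‖fderiv ℝ η x‖ ^ p i :=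
    integrable_finsetSum _ fun i _ => (hDηp i).const_mul _
  have hI := integral_mono_ae (hFη.const_mul lam)
    (hDv.add ((hFS_int.add hDη_int).const_mul (M * q * Lam))) hpt
  simp only [Pi.add_apply] at hI
  rw [integral_add hDv (by exact (hFS_int.add hDη_int).const_mul (M * q * Lam)),
    integral_const_mul, integral_const_mul, integral_add hFS_int hDη_int, integral_const_mul,
    integral_indicator hS, integral_finsetSum _ fun i _ => (hDηp i).const_mul _] at hI
  simp_rw [integral_const_mul] at hI
  linarith

/-- A bounded `C¹` solution of `-div V + β = 0` with coercive `V` of growth `p i - 1`, where each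
`p i` is at least the dimension, has vanishing energy density. -/
lemma sum_norm_fderiv_rpow_eq_zero {E : Type*} [NormedAddCommGroup E] [InnerProductSpace ℝ E]
    [FiniteDimensional ℝ E] [MeasurableSpace E] [BorelSpace E] {ι : Type*} [Fintype ι]
    {p : ι → ℝ} (hp : ∀ i, 1 < p i) (hpn : ∀ i, (Module.finrank ℝ E : ℝ) ≤ p i)
    {lam Lam M : ℝ} (hlam : 0 < lam) (hLam : 0 ≤ Lam) (hM : 0 ≤ M)
    {V : E → E} {β : E → ℝ} (hV : LocallyIntegrable V)
    {u : E → ℝ} (hu : ContDiff ℝ 1 u) (huM : ∀ x, |u x| ≤ M)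
    (hlow : ∀ᵐ x, lam * ∑ i, ‖fderiv ℝ u x‖ ^ p i ≤ fderiv ℝ u x (V x))
    (hup : ∀ᵐ x, ‖V x‖ ≤ Lam * ∑ i, ‖fderiv ℝ u x‖ ^ (p i - 1))
    (hβu : ∀ᵐ x, 0 ≤ β x * u x)
    (hsol : ∀ v : E → ℝ, ContDiff ℝ 1 v → HasCompactSupport v →
      (∫ x, fderiv ℝ v x (V x)) + ∫ x, β x * v x = 0) (x : E) :
    ∑ i, ‖fderiv ℝ u x‖ ^ p i = 0 := by
  set F : E → ℝ := fun x => ∑ i, ‖fderiv ℝ u x‖ ^ p i with hF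
  have hDu : Continuous (fderiv ℝ u) := hu.continuous_fderiv one_ne_zero
  have hFc : Continuous F := continuous_finsetSum _ fun i _ =>
    hDu.norm.rpow_const fun x => Or.inr (by linarith [hp i])
  have hF0 : ∀ x, 0 ≤ F x := fun x => Finset.sum_nonneg fun i _ => by positivity
  obtain ⟨Q, hQ⟩ := (Set.finite_range p).bddAbove
  obtain ⟨q₀, hq₀⟩ := exists_nat_ge Q
  obtain ⟨q, hq0, hq⟩ : ∃ q : ℕ, q ≠ 0 ∧ ∀ i, p i ≤ q := by
    refine ⟨q₀ + 1, by simp, fun i => ?_⟩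
    have := hQ ⟨i, rfl⟩
    push_cast
    linarith
  obtain ⟨C, hC⟩ := exists_scaled_cutoff E
  choose! η hηd hηc hη0 hη1 hηone hηD hηp using hC
  set K := M * q * Lam
  have hK0 : 0 ≤ K := by positivity
  set c : ℝ → ℝ := fun δ => ∑ i, δ ^ (1 - p i) * C (p i) with hc
  have hFη : ∀ R, 1 ≤ R → Integrable fun x => F x * η R x ^ q := fun R hR =>
    (hFc.mul ((hηd R hR).continuous.pow q)).integrable_of_hasCompactSupport
      (((hηc R hR).comp_left (g := fun y => y ^ q) (by simp [hq0])).mul_left)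
  have hFη0 : ∀ R, 1 ≤ R → ∀ x, 0 ≤ F x * η R x ^ q := fun R hR x =>
    mul_nonneg (hF0 x) (pow_nonneg (hη0 R hR x) q)
  have henergy : ∀ R, 1 ≤ R → ∀ δ, 0 < δ → lam * ∫ x, F x * η R x ^ q ≤
      K * (δ * (∫ x in (ball 0 R)ᶜ, F x * η R x ^ q) + c δ) := by
    intro R hR δ hδ
    refine (energy_inequality hp hLam hM hV hu huM hlow hup hβu hsol hq hq0 (hηd R hR) (hηc R hR)
      (hη0 R hR) (hη1 R hR) (S := (ball 0 R)ᶜ) measurableSet_ball.compl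
      (fun x hx => hηD R hR x (not_not.1 hx)) hδ).trans ?_
    simp only [hc]
    gcongr with i
    exact hηp R hR _ (hpn i)
  have hball : ∀ R, 1 ≤ R → ∫ x in ball 0 R, F x ≤ ∫ x, F x * η R x ^ q := by
    intro R hR
    rw [setIntegral_congr_fun (g := fun x => F x * η R x ^ q) measurableSet_ball
      fun x hx => by simp [hηone R hR x hx]]
    exact setIntegral_le_integral (hFη R hR) (ae_of_all _ (hFη0 R hR))
  have hcover : AECover (volume : Measure E) atTop fun R : ℝ => ball (0 : E) R :=
    aecover_ball tendsto_id
  have hFint : Integrable F := by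
    obtain ⟨δ, hδ, hδK⟩ : ∃ δ : ℝ, 0 < δ ∧ K * δ ≤ lam / 2 := by
      refine ⟨lam / (2 * (K + 1)), by positivity, ?_⟩
      rw [← mul_div_assoc, div_le_div_iff₀ (by positivity) two_pos]
      nlinarith
    refine hcover.integrable_of_integral_bounded_of_nonneg_ae (2 / lam * (K * c δ))
      (fun R => (hFc.locallyIntegrable.integrableOn_isCompact
        (isCompact_closedBall (0 : E) R)).mono_set ball_subset_closedBall) (ae_of_all _ hF0) ?_
    filter_upwards [eventually_ge_atTop 1] with R hR
    refine (hball R hR).trans ?_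
    have h1 := henergy R hR δ hδ
    have h2 : ∫ x in (ball 0 R)ᶜ, F x * η R x ^ q ≤ ∫ x, F x * η R x ^ q :=
      setIntegral_le_integral (hFη R hR) (ae_of_all _ (hFη0 R hR))
    have h3 : 0 ≤ ∫ x, F x * η R x ^ q := integral_nonneg (hFη0 R hR)
    have h4 : K * δ * ∫ x in (ball 0 R)ᶜ, F x * η R x ^ q ≤
        lam / 2 * ∫ x, F x * η R x ^ q :=
      (mul_le_mul_of_nonneg_left h2 (by positivity)).trans (mul_le_mul_of_nonneg_right hδK h3)
    have h5 : lam / 2 * ∫ x, F x * η R x ^ q ≤ K * c δ := by linarith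
    calc ∫ x, F x * η R x ^ q = 2 / lam * (lam / 2 * ∫ x, F x * η R x ^ q) := by
          field_simp
      _ ≤ _ := mul_le_mul_of_nonneg_left h5 (by positivity)
  have hlimball := hcover.integral_tendsto_of_countably_generated hFint
  have hstep : ∀ δ, 0 < δ → lam * ∫ x, F x ≤ K * c δ := by
    intro δ hδ
    have hR : Tendsto (fun R : ℝ => K * (δ * ((∫ x, F x) - ∫ x in ball 0 R, F x) + c δ)) atTop
        (𝓝 (K * (δ * ((∫ x, F x) - ∫ x, F x) + c δ))) :=
      (((tendsto_const_nhds.sub hlimball).const_mul δ).add_const _).const_mul K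
    rw [sub_self, mul_zero, zero_add] at hR
    refine le_of_tendsto_of_tendsto (hlimball.const_mul lam) hR ?_
    filter_upwards [eventually_ge_atTop 1] with R hR1
    refine (mul_le_mul_of_nonneg_left (hball R hR1) hlam.le).trans
      ((henergy R hR1 δ hδ).trans ?_)
    have h1 : (∫ x, F x) - ∫ x in ball 0 R, F x = ∫ x in (ball 0 R)ᶜ, F x := by
      rw [← integral_add_compl (measurableSet_ball (x := (0 : E)) (ε := R)) hFint]
      ring
    rw [h1]
    have h2 : ∫ x in (ball 0 R)ᶜ, F x * η R x ^ q ≤ ∫ x in (ball 0 R)ᶜ, F x :=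
      integral_mono (hFη R hR1).integrableOn hFint.integrableOn fun x =>
        mul_le_of_le_one_right (hF0 x) (pow_le_one₀ (hη0 R hR1 x) (hη1 R hR1 x))
    gcongr
  have hclim : Tendsto (fun δ => K * c δ) atTop (𝓝 0) := by
    have : Tendsto c atTop (𝓝 (∑ i, 0 * C (p i))) := by
      refine tendsto_finsetSum _ fun i _ => Tendsto.mul_const _ ?_
      have := tendsto_rpow_neg_atTop (y := p i - 1) (by linarith [hp i])
      simpa using this
    simpa using this.const_mul K
  have hle : lam * ∫ x, F x ≤ 0 :=
    ge_of_tendsto hclim ((eventually_gt_atTop 0).mono hstep)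
  have hzero : ∫ x, F x = 0 :=
    le_antisymm (nonpos_of_mul_nonpos_right hle hlam) (integral_nonneg hF0)
  have hae := (integral_eq_zero_iff_of_nonneg hF0 hFint).1 hzero
  exact congrFun ((hFc.ae_eq_iff_eq volume continuous_zero).1 hae) x

/-- Liouville theorem for sums of `p`-Laplace type operators with exponents at least
the dimension: every bounded solution of
`-∂_k (∑ i, a i (x, u) |∇u|^(pᵢ-2) ∂_k u) + b (x, u) = 0` in `ℝⁿ` is constant,
provided `pᵢ ≥ n` for all `i`. -/
theorem liouville_p_laplace_type_p_ge_n
    (n N : ℕ) (hn : 1 ≤ n) (hN : 1 ≤ N)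
    (p : Fin N → ℝ) (hp_mono : Monotone p) (hp1 : ∀ i, 1 < p i)
    (hpn : ∀ i, (n : ℝ) ≤ p i)
    (lam Lam : ℝ) (hlam : 0 < lam) (hLam : lam ≤ Lam)
    (a : Fin N → EuclideanSpace ℝ (Fin n) → ℝ → ℝ)
    (ha_meas : ∀ i s, Measurable fun x => a i x s)
    (ha_cont : ∀ i (x : EuclideanSpace ℝ (Fin n)), Continuous fun s => a i x s)
    (ha_bnd : ∀ i, ∀ᵐ x ∂(volume : Measure (EuclideanSpace ℝ (Fin n))),
      ∀ s : ℝ, lam ≤ a i x s ∧ a i x s ≤ Lam)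
    (b : EuclideanSpace ℝ (Fin n) → ℝ → ℝ)
    (hb_meas : ∀ s, Measurable fun x => b x s)
    (hb_cont : ∀ x : EuclideanSpace ℝ (Fin n), Continuous fun s => b x s)
    (B : ℝ)
    (hb_bnd : ∀ᵐ x ∂(volume : Measure (EuclideanSpace ℝ (Fin n))), ∀ s : ℝ, |b x s| ≤ B)
    (hb_sign : ∀ᵐ x ∂(volume : Measure (EuclideanSpace ℝ (Fin n))), ∀ s : ℝ, 0 ≤ b x s * s)
    (u : EuclideanSpace ℝ (Fin n) → ℝ) (hu : ContDiff ℝ 1 u)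
    (hu_bdd : ∃ M : ℝ, ∀ x, |u x| ≤ M)
    (hu_sol : ∀ v : EuclideanSpace ℝ (Fin n) → ℝ, ContDiff ℝ (⊤ : ℕ∞) v →
      HasCompactSupport v →
      (∫ x, ∑ i, a i x (u x) * ‖gradient u x‖ ^ (p i - 2) * ⟪gradient u x, gradient v x⟫) +
      (∫ x, b x (u x) * v x) = 0) :
    ∃ c : ℝ, ∀ x, u x = c := by
  obtain ⟨M, hM⟩ := hu_bdd
  have hLam0 : 0 ≤ Lam := hlam.le.trans hLam
  have hDu : Continuous (fderiv ℝ u) := hu.continuous_fderiv one_ne_zero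
  have hnorm : ∀ x, ‖gradient u x‖ = ‖fderiv ℝ u x‖ := fun x => by simp [gradient]
  have hgrad : Continuous (gradient u) := by
    unfold gradient
    exact (LinearIsometryEquiv.continuous _).comp hDu
  have hpow : ∀ i, Continuous fun x => ‖fderiv ℝ u x‖ ^ (p i - 1) := fun i =>
    hDu.norm.rpow_const fun x => Or.inr (by linarith [hp1 i])
  have hbnd : ∀ᵐ x, ∀ i, lam ≤ a i x (u x) ∧ a i x (u x) ≤ Lam :=
    ae_all_iff.2 fun i => (ha_bnd i).mono fun x hx => hx (u x)
  have hcara : ∀ f : EuclideanSpace ℝ (Fin n) → ℝ → ℝ, (∀ s, Measurable fun x => f x s) →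
      (∀ x, Continuous fun s => f x s) → Measurable fun x => f x (u x) := by
    intro f hfm hfc
    have := measurable_uncurry_of_continuous_of_measurable (u := fun s x => f x s) hfc hfm
    exact this.comp (hu.continuous.measurable.prodMk measurable_id)
  set V : EuclideanSpace ℝ (Fin n) → EuclideanSpace ℝ (Fin n) := fun x =>
    (∑ i, a i x (u x) * ‖gradient u x‖ ^ (p i - 2)) • gradient u x with hVdef
  have hrpow : ∀ i x, ‖gradient u x‖ ^ (p i - 2) * ‖gradient u x‖ =
      ‖fderiv ℝ u x‖ ^ (p i - 1) := fun i x => by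
    rw [← hnorm, ← Real.rpow_add_one' (norm_nonneg _) (by linarith [hp1 i])]
    congr 1
    ring
  have hup : ∀ᵐ x, ‖V x‖ ≤ Lam * ∑ i, ‖fderiv ℝ u x‖ ^ (p i - 1) := by
    filter_upwards [hbnd] with x hx
    have hnn : 0 ≤ ∑ i, a i x (u x) * ‖gradient u x‖ ^ (p i - 2) :=
      Finset.sum_nonneg fun i _ => mul_nonneg (hlam.le.trans (hx i).1) (by positivity)
    rw [hVdef, norm_smul, Real.norm_of_nonneg hnn, Finset.sum_mul, Finset.mul_sum]
    refine Finset.sum_le_sum fun i _ => ?_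
    rw [mul_assoc, hrpow]
    exact mul_le_mul_of_nonneg_right (hx i).2 (by positivity)
  have hlow : ∀ᵐ x, lam * ∑ i, ‖fderiv ℝ u x‖ ^ p i ≤ fderiv ℝ u x (V x) := by
    filter_upwards [hbnd] with x hx
    rw [hVdef, map_smul, smul_eq_mul, ← inner_gradient_left, real_inner_self_eq_norm_sq,
      Finset.sum_mul, Finset.mul_sum]
    refine Finset.sum_le_sum fun i _ => ?_
    have : ‖fderiv ℝ u x‖ ^ p i = ‖gradient u x‖ ^ (p i - 2) * ‖gradient u x‖ ^ 2 := by
      rw [pow_two, ← mul_assoc, hrpow, hnorm,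
        ← Real.rpow_add_one' (norm_nonneg _) (by linarith [hp1 i])]
      congr 1
      ring
    rw [this, mul_assoc]
    exact mul_le_mul_of_nonneg_right (hx i).1 (by positivity)
  have hVm : Measurable V := by
    refine Measurable.fun_smul (Finset.measurable_fun_sum _ fun i _ => ?_) hgrad.measurable
    exact (hcara (a i) (ha_meas i) (ha_cont i)).mul (hgrad.measurable.norm.pow_const _)
  have hV : LocallyIntegrable V := by
    have hcont : Continuous fun x => Lam * ∑ i, ‖fderiv ℝ u x‖ ^ (p i - 1) :=
      continuous_const.mul (continuous_finsetSum _ fun i _ => hpow i)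
    refine hcont.locallyIntegrable.mono hVm.aestronglyMeasurable ?_
    filter_upwards [hup] with x hx using hx.trans (le_abs_self _)
  have hβ : LocallyIntegrable fun x => b x (u x) := by
    refine (continuous_const (y := B)).locallyIntegrable.mono
      (hcara b hb_meas hb_cont).aestronglyMeasurable ?_
    filter_upwards [hb_bnd] with x hx using (hx (u x)).trans (le_abs_self _)
  have hsol : ∀ v : EuclideanSpace ℝ (Fin n) → ℝ, ContDiff ℝ 1 v → HasCompactSupport v →
      (∫ x, fderiv ℝ v x (V x)) + ∫ x, b x (u x) * v x = 0 := by
    intro v hv hvc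
    refine integral_fderiv_add_integral_eq_zero_of_smooth hV hβ (fun w hw hwc => ?_) hv hvc
    rw [← hu_sol w hw hwc]
    congr 2
    ext x
    simp only [hVdef, map_smul, smul_eq_mul, Finset.sum_mul, inner_gradient_right, conj_trivial]
  have hzero := sum_norm_fderiv_rpow_eq_zero hp1 (by simpa using hpn) hlam hLam0
    ((abs_nonneg _).trans (hM 0)) hV hu hM hlow hup (hb_sign.mono fun x hx => hx (u x)) hsol
  have hfd : ∀ x, fderiv ℝ u x = 0 := by
    intro x
    have h := (Finset.sum_eq_zero_iff_of_nonneg fun i _ => by positivity).1 (hzero x) ⟨0, hN⟩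
      (Finset.mem_univ _)
    exact norm_eq_zero.1 ((Real.rpow_eq_zero (norm_nonneg _) (by linarith [hp1 ⟨0, hN⟩])).1 h)
  exact ⟨u 0, fun x => is_const_of_fderiv_eq_zero (hu.differentiable one_ne_zero) hfd x 0⟩
end

section
/- Liouville theorem under the integral growth condition (2.16): let n ≥ 1, N ≥ 1, real exponents 1 < p₁ ≤ ⋯ ≤ p_N, let a_i : ℝⁿ × ℝ → ℝ (i = 1,…,N) satisfy λ ≤ a_i(x,s) ≤ Λ for a.e. x ∈ ℝⁿ and all s ∈ ℝ, where 0 < λ ≤ Λ, and let b : ℝⁿ × ℝ → ℝ be bounded with b(x,s)·s ≥ 0. Suppose u is a solution of -∂_{x_k}(∑_{i=1}^N a_i(x,u)|∇u|^{p_i−2} ∂_{x_k} u) + b(x,u) = 0 in ℝⁿ such that there exists M > 0 with ∑_{i=1}^N r^{−p_i} ∫_{B_r \ B_{r/2}} |u|^{p_i} dx ≤ M for every r ≥ 1. Then u is constant. -/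
open MeasureTheory Metric
open scoped RealInnerProductSpace

/-- A compactly supported `C¹` function is a `C¹`-uniform limit of test functions supported in a
fixed neighbourhood of its support. -/
theorem exists_smooth_approx_of_contDiff_one {E : Type*} [NormedAddCommGroup E]
    [NormedSpace ℝ E] [FiniteDimensional ℝ E] [MeasurableSpace E] [BorelSpace E]
    (μ : Measure E) [μ.IsAddHaarMeasure]
    {v : E → ℝ} (hv : ContDiff ℝ 1 v) (hvc : HasCompactSupport v) {ε : ℝ} (hε : 0 < ε) :
    ∃ w : E → ℝ, ContDiff ℝ (⊤ : ℕ∞) w ∧ HasCompactSupport w ∧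
      Function.support w ⊆ thickening 1 (Function.support v) ∧
      (∀ x, |w x - v x| ≤ ε) ∧ ∀ x, ‖fderiv ℝ w x - fderiv ℝ v x‖ ≤ ε := by
  have hdc : Continuous (fderiv ℝ v) := hv.continuous_fderiv one_ne_zero
  obtain ⟨δ₁, hδ₁, h₁⟩ := Metric.uniformContinuous_iff.1
    (hvc.uniformContinuous_of_continuous hv.continuous) ε hε
  obtain ⟨δ₂, hδ₂, h₂⟩ := Metric.uniformContinuous_iff.1
    ((hvc.fderiv ℝ).uniformContinuous_of_continuous hdc) ε hε
  set δ := min 1 (min δ₁ δ₂) with hδdef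
  have hδ : 0 < δ := lt_min one_pos (lt_min hδ₁ hδ₂)
  have hδ1 : δ ≤ δ₁ := (min_le_right _ _).trans (min_le_left _ _)
  have hδ2 : δ ≤ δ₂ := (min_le_right _ _).trans (min_le_right _ _)
  let φ : ContDiffBump (0 : E) := ⟨δ / 2, δ, half_pos hδ, half_lt_self hδ⟩
  refine ⟨convolution (φ.normed μ) v (ContinuousLinearMap.lsmul ℝ ℝ) μ, ?_, ?_, ?_, ?_, ?_⟩
  · exact φ.hasCompactSupport_normed.contDiff_convolution_left _ φ.contDiff_normed
      hv.continuous.locallyIntegrable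
  · exact φ.hasCompactSupport_normed.convolution _ hvc
  · intro x hx
    obtain ⟨y, hy, z, hz, rfl⟩ := Set.mem_add.1 (support_convolution_subset _ hx)
    rw [φ.support_normed_eq, mem_ball_zero_iff] at hy
    refine mem_thickening_iff.2 ⟨z, hz, ?_⟩
    rw [dist_eq_norm, add_sub_cancel_right]
    exact hy.trans_le (min_le_left _ _)
  · intro x
    rw [← Real.dist_eq]
    exact ContDiffBump.dist_normed_convolution_le hv.continuous.aestronglyMeasurable
      fun y hy => (h₁ ((mem_ball.1 hy).trans_le hδ1)).le
  · intro x
    have hfd := hvc.hasFDerivAt_convolution_right (μ := μ) (ContinuousLinearMap.lsmul ℝ ℝ)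
      (φ.contDiff_normed (μ := μ) (n := 0)).continuous.locallyIntegrable hv x
    rw [hfd.fderiv, ← dist_eq_norm]
    exact ContDiffBump.dist_normed_convolution_le (φ := φ) (μ := μ) hdc.aestronglyMeasurable
      fun y hy => (h₂ ((mem_ball.1 hy).trans_le hδ2)).le

/-- A weak identity tested by smooth functions extends to compactly supported `C¹` functions. -/
theorem integral_fderiv_apply_add_eq_zero_of_smooth {E : Type*} [NormedAddCommGroup E]
    [NormedSpace ℝ E] [FiniteDimensional ℝ E] [MeasurableSpace E] [BorelSpace E]
    (μ : Measure E) [μ.IsAddHaarMeasure] {F : E → E} {g : E → ℝ}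
    (hF : LocallyIntegrable F μ) (hg : LocallyIntegrable g μ)
    (h : ∀ w : E → ℝ, ContDiff ℝ (⊤ : ℕ∞) w → HasCompactSupport w →
      (∫ x, fderiv ℝ w x (F x) ∂μ) + (∫ x, g x * w x ∂μ) = 0)
    {v : E → ℝ} (hv : ContDiff ℝ 1 v) (hvc : HasCompactSupport v) :
    Integrable (fun x => fderiv ℝ v x (F x)) μ ∧ Integrable (fun x => g x * v x) μ ∧
      (∫ x, fderiv ℝ v x (F x) ∂μ) + (∫ x, g x * v x ∂μ) = 0 := by
  have : ProperSpace E := FiniteDimensional.proper_real E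
  have intg : ∀ w : E → ℝ, ContDiff ℝ 1 w → HasCompactSupport w →
      Integrable (fun x => g x * w x) μ := fun w hw hwc =>
    hg.integrable_smul_right_of_hasCompactSupport hw.continuous hwc
  have intF : ∀ w : E → ℝ, ContDiff ℝ 1 w → HasCompactSupport w →
      Integrable (fun x => fderiv ℝ w x (F x)) μ := by
    intro w hw hwc
    have hwd : Continuous (fderiv ℝ w) := hw.continuous_fderiv one_ne_zero
    have h1 : Integrable (fun x => ‖fderiv ℝ w x‖ * ‖F x‖) μ := by
      have hFn : LocallyIntegrable (fun x => ‖F x‖) μ :=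
        hF.mono hF.aestronglyMeasurable.norm (by simp)
      have := hFn.integrable_smul_right_of_hasCompactSupport hwd.norm (hwc.fderiv ℝ).norm
      simpa [mul_comm] using this
    refine h1.mono' ?_ (Filter.Eventually.of_forall fun x => (fderiv ℝ w x).le_opNorm _)
    have happ := (isBoundedBilinearMap_apply (𝕜 := ℝ) (E := E) (F := ℝ)).continuous
    exact happ.comp_aestronglyMeasurable
      (hwd.aestronglyMeasurable.prodMk hF.aestronglyMeasurable)
  refine ⟨intF v hv hvc, intg v hv hvc, ?_⟩
  set K := cthickening 1 (Function.support v) with hK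
  have hKc : IsCompact K := by
    refine isCompact_of_isClosed_isBounded isClosed_cthickening (Bornology.IsBounded.cthickening ?_)
    exact hvc.isBounded.subset (subset_tsupport v)
  set C := (∫ x in K, ‖F x‖ ∂μ) + ∫ x in K, |g x| ∂μ with hC
  have key : ∀ ε : ℝ, 0 < ε →
      |(∫ x, fderiv ℝ v x (F x) ∂μ) + (∫ x, g x * v x ∂μ)| ≤ ε * C := by
    intro ε hε
    obtain ⟨w, hw, hwc, hws, h0, h1⟩ := exists_smooth_approx_of_contDiff_one μ hv hvc hε
    have hw1 : ContDiff ℝ 1 w := hw.of_le (by exact_mod_cast le_top)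
    have hwK : tsupport w ⊆ K :=
      closure_minimal (hws.trans (thickening_subset_cthickening _ _)) isClosed_cthickening
    have hvK : tsupport v ⊆ K := closure_subset_cthickening _ _
    have e1 : ‖∫ x in K, (fderiv ℝ w x - fderiv ℝ v x) (F x) ∂μ‖ ≤
        ∫ x in K, ε * ‖F x‖ ∂μ := by
      refine norm_integral_le_of_norm_le ((hF.integrableOn_isCompact hKc).norm.const_mul ε)
        (Filter.Eventually.of_forall fun x => ?_)
      exact ((fderiv ℝ w x - fderiv ℝ v x).le_opNorm _).trans
        (mul_le_mul_of_nonneg_right (h1 x) (norm_nonneg _))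
    have e2 : ‖∫ x in K, g x * (w x - v x) ∂μ‖ ≤ ∫ x in K, ε * |g x| ∂μ := by
      refine norm_integral_le_of_norm_le ((hg.integrableOn_isCompact hKc).norm.const_mul ε)
        (Filter.Eventually.of_forall fun x => ?_)
      rw [norm_mul, mul_comm]
      exact mul_le_mul_of_nonneg_right (h0 x) (norm_nonneg _)
    rw [setIntegral_eq_integral_of_forall_compl_eq_zero] at e1 e2
    · rw [integral_const_mul] at e1 e2
      have hs1 : ∫ x, (fderiv ℝ w x - fderiv ℝ v x) (F x) ∂μ =
          (∫ x, fderiv ℝ w x (F x) ∂μ) - ∫ x, fderiv ℝ v x (F x) ∂μ := by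
        rw [← integral_sub (intF w hw1 hwc) (intF v hv hvc)]; rfl
      have hs2 : ∫ x, g x * (w x - v x) ∂μ = (∫ x, g x * w x ∂μ) - ∫ x, g x * v x ∂μ := by
        rw [← integral_sub (intg w hw1 hwc) (intg v hv hvc)]; simp only [mul_sub]
      rw [hs1, Real.norm_eq_abs] at e1
      rw [hs2, Real.norm_eq_abs] at e2
      have h3 := h w hw hwc
      rw [abs_le] at e1 e2 ⊢
      rw [hC]
      constructor <;> nlinarith
    · intro x hx
      rw [image_eq_zero_of_notMem_tsupport (fun hh => hx (hwK hh)),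
        image_eq_zero_of_notMem_tsupport (fun hh => hx (hvK hh))]
      simp
    · intro x hx
      rw [image_eq_zero_of_notMem_tsupport
          (fun hh => hx (hwK (tsupport_fderiv_subset ℝ hh))),
        image_eq_zero_of_notMem_tsupport
          (fun hh => hx (hvK (tsupport_fderiv_subset ℝ hh)))]
      simp
  rw [← abs_nonpos_iff]
  have ht : Filter.Tendsto (fun ε : ℝ => ε * C) (nhdsWithin 0 (Set.Ioi 0)) (nhds 0) := by
    have : Filter.Tendsto (fun ε : ℝ => ε * C) (nhds 0) (nhds (0 * C)) :=
      (continuous_id.mul continuous_const).tendsto 0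
    rw [zero_mul] at this
    exact this.mono_left nhdsWithin_le_nhds
  exact ge_of_tendsto ht (Filter.eventually_of_mem self_mem_nhdsWithin key)

/-- Young's inequality with a parameter `t` and a cut-off factor `η`. -/
theorem pow_pred_mul_mul_rpow_le {η x y t p : ℝ} {m : ℕ} (hη0 : 0 ≤ η) (hη1 : η ≤ 1)
    (hx : 0 ≤ x) (hy : 0 ≤ y) (ht : 0 < t) (hp : 1 < p) (hm : p ≤ m) :
    η ^ (m - 1) * x * y ^ (p - 1) ≤ t ^ (p - 1) * x ^ p + t⁻¹ * (η ^ m * y ^ p) := by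
  have hm1 : 1 < m := by exact_mod_cast hp.trans_le hm
  rcases hη0.eq_or_lt with rfl | hη
  · rw [zero_pow (by omega), zero_pow (by omega)]
    simp only [zero_mul, mul_zero, add_zero]
    positivity
  have hsplit : ∀ z : ℝ, 0 ≤ z → z ^ p = z ^ (p - 1) * z := by
    intro z hz
    rcases hz.eq_or_lt with rfl | hz
    · rw [Real.zero_rpow (by linarith), mul_zero]
    · rw [← Real.rpow_add_one hz.ne']; ring_nf
  have hyoung : x * (η * y) ^ (p - 1) ≤ t ^ (p - 1) * x ^ p + t⁻¹ * (η * y) ^ p := by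
    have hz : 0 ≤ η * y := by positivity
    rcases le_total (η * y) (t * x) with h | h
    · calc x * (η * y) ^ (p - 1) ≤ x * (t * x) ^ (p - 1) := by
            gcongr
        _ = t ^ (p - 1) * x ^ p := by
            rw [Real.mul_rpow ht.le hx, hsplit x hx]; ring
        _ ≤ _ := le_add_of_nonneg_right (by positivity)
    · calc x * (η * y) ^ (p - 1) ≤ (t⁻¹ * (η * y)) * (η * y) ^ (p - 1) := by
            gcongr
            rw [inv_mul_eq_div, le_div_iff₀ ht]; linarith
        _ = t⁻¹ * (η * y) ^ p := by rw [hsplit _ hz]; ring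
        _ ≤ _ := le_add_of_nonneg_left (by positivity)
  have hq0 : 0 ≤ η ^ ((m : ℝ) - p) := by positivity
  have hq1 : η ^ ((m : ℝ) - p) ≤ 1 := Real.rpow_le_one hη0 hη1 (by linarith)
  have e1 : η ^ (m - 1) = η ^ ((m : ℝ) - p) * η ^ (p - 1) := by
    rw [← Real.rpow_add hη, ← Real.rpow_natCast, Nat.cast_sub hm1.le]
    simp
  have e2 : η ^ m = η ^ ((m : ℝ) - p) * η ^ p := by
    rw [← Real.rpow_add hη, ← Real.rpow_natCast]
    norm_num
  rw [Real.mul_rpow hη0 hy, Real.mul_rpow hη0 hy] at hyoung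
  have hA : 0 ≤ t ^ (p - 1) * x ^ p := by positivity
  rw [e1, e2]
  nlinarith [mul_le_mul_of_nonneg_left hyoung hq0, mul_le_mul_of_nonneg_right hq1 hA]

/-- If a cut-off energy on each ball is controlled by a constant that can be made small, up to a
multiple of the energy on the outer annulus, then the energy density vanishes. -/
theorem continuous_eq_zero_of_cutoff_energy_le {E : Type*} [NormedAddCommGroup E]
    [NormedSpace ℝ E] [FiniteDimensional ℝ E] [MeasurableSpace E] [BorelSpace E]
    (μ : Measure E) [μ.IsAddHaarMeasure] {G : E → ℝ} (hG : Continuous G) (hG0 : ∀ x, 0 ≤ G x)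
    {lam L : ℝ} (hlam : 0 < lam) (hL : 0 < L) {T : ℝ → ℝ}
    (hT : Filter.Tendsto T (nhdsWithin 0 (Set.Ioi 0)) (nhds 0))
    (h : ∀ r : ℝ, 1 ≤ r → ∃ φ : E → ℝ, Continuous φ ∧ (∀ x, 0 ≤ φ x) ∧ (∀ x, φ x ≤ 1) ∧
      (∀ x ∈ ball (0 : E) (r / 2), φ x = 1) ∧ (∀ x ∉ ball (0 : E) r, φ x = 0) ∧
      ∀ t : ℝ, 0 < t → lam * ∫ x in ball 0 r, φ x * G x ∂μ ≤
        T t + L * t⁻¹ * ∫ x in ball (0 : E) r \ ball 0 (r / 2), φ x * G x ∂μ) :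
    ∀ x, G x = 0 := by
  have : ProperSpace E := FiniteDimensional.proper_real E
  have hint : ∀ r : ℝ, IntegrableOn G (ball (0 : E) r) μ := fun r =>
    (hG.locallyIntegrable.integrableOn_isCompact (isCompact_closedBall 0 r)).mono_set
      ball_subset_closedBall
  have hball : ∀ r : ℝ, 1 ≤ r → ball (0 : E) (r / 2) ⊆ ball 0 r := fun r hr =>
    ball_subset_ball (by linarith)
  have hφint : ∀ (r : ℝ) (φ : E → ℝ), Continuous φ →
      IntegrableOn (fun x => φ x * G x) (ball (0 : E) r) μ := fun r φ hφ =>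
    ((hφ.mul hG).locallyIntegrable.integrableOn_isCompact (isCompact_closedBall 0 r)).mono_set
      ball_subset_closedBall
  have hlow : ∀ (r : ℝ) (φ : E → ℝ), 1 ≤ r → Continuous φ → (∀ x, 0 ≤ φ x) →
      (∀ x ∈ ball (0 : E) (r / 2), φ x = 1) →
      ∫ x in ball (0 : E) (r / 2), G x ∂μ ≤ ∫ x in ball 0 r, φ x * G x ∂μ := by
    intro r φ hr hφ hφ0 hφ1
    calc ∫ x in ball (0 : E) (r / 2), G x ∂μ = ∫ x in ball (0 : E) (r / 2), φ x * G x ∂μ :=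
          setIntegral_congr_fun measurableSet_ball fun x hx => by
            simp only [hφ1 x hx, one_mul]
      _ ≤ _ := setIntegral_mono_set (hφint r φ hφ)
          (Filter.Eventually.of_forall fun x => mul_nonneg (hφ0 x) (hG0 x))
          (hball r hr).eventuallyLE
  have hcov : AECover μ Filter.atTop fun r : ℝ => ball (0 : E) r := aecover_ball Filter.tendsto_id
  have hhalf : Filter.Tendsto (fun r : ℝ => r / 2) Filter.atTop Filter.atTop :=
    Filter.tendsto_id.atTop_div_const two_pos
  have hcov2 : AECover μ Filter.atTop fun r : ℝ => ball (0 : E) (r / 2) := aecover_ball hhalf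
  have hGint : Integrable G μ := by
    set t₀ := 2 * L / lam with ht₀
    have ht₀pos : 0 < t₀ := by positivity
    refine hcov2.integrable_of_integral_bounded_of_nonneg_ae (2 * T t₀ / lam)
      (fun r => hint _) (Filter.Eventually.of_forall hG0) ?_
    filter_upwards [Filter.eventually_ge_atTop 1] with r hr
    obtain ⟨φ, hφ, hφ0, -, hφ2, -, hE⟩ := h r hr
    have h1 := hE t₀ ht₀pos
    have h2 : ∫ x in ball (0 : E) r \ ball 0 (r / 2), φ x * G x ∂μ ≤
        ∫ x in ball (0 : E) r, φ x * G x ∂μ :=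
      setIntegral_mono_set (hφint r φ hφ)
        (Filter.Eventually.of_forall fun x => mul_nonneg (hφ0 x) (hG0 x))
        Set.sdiff_subset.eventuallyLE
    have h3 := hlow r φ hr hφ hφ0 hφ2
    have h4 : L * t₀⁻¹ = lam / 2 := by rw [ht₀]; field_simp
    rw [h4] at h1
    rw [le_div_iff₀ hlam]
    nlinarith
  have hlim := hcov.integral_tendsto_of_countably_generated hGint
  have hlim2 := hcov2.integral_tendsto_of_countably_generated hGint
  have key : ∀ t : ℝ, 0 < t → lam * ∫ x, G x ∂μ ≤ T t := by
    intro t ht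
    have hr : Filter.Tendsto (fun r : ℝ => T t + L * t⁻¹ *
        ((∫ x in ball (0 : E) r, G x ∂μ) - ∫ x in ball (0 : E) (r / 2), G x ∂μ))
        Filter.atTop (nhds (T t + L * t⁻¹ * ((∫ x, G x ∂μ) - ∫ x, G x ∂μ))) :=
      ((hlim.sub hlim2).const_mul _).const_add _
    rw [sub_self, mul_zero, add_zero] at hr
    refine le_of_tendsto_of_tendsto (hlim2.const_mul lam) hr ?_
    filter_upwards [Filter.eventually_ge_atTop 1] with r hr
    obtain ⟨φ, hφ, hφ0, hφ1, hφ2, -, hE⟩ := h r hr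
    have h1 := hE t ht
    have h3 := hlow r φ hr hφ hφ0 hφ2
    have h2 : ∫ x in ball (0 : E) r \ ball 0 (r / 2), φ x * G x ∂μ ≤
        ∫ x in ball (0 : E) r \ ball 0 (r / 2), G x ∂μ :=
      setIntegral_mono ((hφint r φ hφ).mono_set Set.sdiff_subset)
        ((hint r).mono_set Set.sdiff_subset)
        fun x => mul_le_of_le_one_left (hG0 x) (hφ1 x)
    rw [setIntegral_sdiff measurableSet_ball (hint r) (hball r hr)] at h2
    have h5 : 0 ≤ L * t⁻¹ := by positivity
    nlinarith [mul_le_mul_of_nonneg_left h2 h5, mul_le_mul_of_nonneg_left h3 hlam.le]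
  have h0 : lam * ∫ x, G x ∂μ ≤ 0 :=
    ge_of_tendsto hT (Filter.eventually_of_mem self_mem_nhdsWithin key)
  have h1 : ∫ x, G x ∂μ = 0 :=
    le_antisymm (by nlinarith) (integral_nonneg hG0)
  rw [integral_eq_zero_iff_of_nonneg hG0 hGint] at h1
  have h2 := (hG.ae_eq_iff_eq μ continuous_zero).1 h1
  exact fun x => congrFun h2 x

theorem exists_cutoff_of_norm_fderiv_le (E : Type*) [NormedAddCommGroup E]
    [InnerProductSpace ℝ E] [FiniteDimensional ℝ E] :
    ∃ C : ℝ, 0 ≤ C ∧ ∀ r : ℝ, 0 < r → ∃ η : E → ℝ, ContDiff ℝ 1 η ∧ HasCompactSupport η ∧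
      (∀ x, 0 ≤ η x) ∧ (∀ x, η x ≤ 1) ∧ (∀ x ∈ ball (0 : E) (r / 2), η x = 1) ∧
      (∀ x ∉ ball (0 : E) r, η x = 0) ∧ (∀ x, ‖fderiv ℝ η x‖ ≤ C / r) ∧
      ∀ x ∈ ball (0 : E) (r / 2), fderiv ℝ η x = 0 := by
  have : ProperSpace E := FiniteDimensional.proper_real E
  let φ : ContDiffBump (0 : E) := ⟨1 / 2, 1, by norm_num, by norm_num⟩
  have hφ : ContDiff ℝ 1 φ := φ.contDiff
  obtain ⟨C, hC⟩ := (hφ.continuous_fderiv one_ne_zero).bounded_above_of_compact_support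
    (φ.hasCompactSupport.fderiv ℝ)
  have hC0 : 0 ≤ C := (norm_nonneg _).trans (hC 0)
  refine ⟨C, hC0, fun r hr => ?_⟩
  have hone : ∀ x ∈ ball (0 : E) (r / 2), φ (r⁻¹ • x) = 1 := by
    intro x hx
    refine φ.one_of_mem_closedBall ?_
    rw [mem_ball_zero_iff] at hx
    rw [mem_closedBall_zero_iff, norm_smul, norm_inv, Real.norm_of_nonneg hr.le,
      inv_mul_le_iff₀ hr]
    change ‖x‖ ≤ r * (1 / 2)
    linarith
  have hzero : ∀ x ∉ ball (0 : E) r, φ (r⁻¹ • x) = 0 := by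
    intro x hx
    refine φ.zero_of_le_dist ?_
    rw [mem_ball_zero_iff, not_lt] at hx
    rw [dist_zero_right, norm_smul, norm_inv, Real.norm_of_nonneg hr.le, le_inv_mul_iff₀ hr]
    change r * 1 ≤ ‖x‖
    linarith
  refine ⟨fun x => φ (r⁻¹ • x), hφ.comp (contDiff_const_smul _), ?_, fun x => φ.nonneg,
    fun x => φ.le_one, hone, hzero, fun x => ?_, fun x hx => ?_⟩
  · exact HasCompactSupport.intro (isCompact_closedBall 0 r) fun x hx =>
      hzero x fun h => hx (ball_subset_closedBall h)
  · have h1 : HasFDerivAt (fun x : E => r⁻¹ • x) (r⁻¹ • ContinuousLinearMap.id ℝ E) x :=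
      (hasFDerivAt_id x).const_smul r⁻¹
    have h2 := ((hφ.differentiable one_ne_zero (r⁻¹ • x)).hasFDerivAt).comp x h1
    rw [show fderiv ℝ (fun x => φ (r⁻¹ • x)) x = _ from h2.fderiv,
      ContinuousLinearMap.comp_smul, ContinuousLinearMap.comp_id, norm_smul, norm_inv,
      Real.norm_of_nonneg hr.le, inv_mul_eq_div]
    gcongr
    exact hC _
  · have h1 : (fun x => φ (r⁻¹ • x)) =ᶠ[nhds x] fun _ => (1 : ℝ) :=
      Filter.eventually_of_mem (isOpen_ball.mem_nhds hx) hone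
    rw [h1.fderiv_eq, fderiv_fun_const]; rfl

theorem Real.rpow_sub_two_mul_sq {w p : ℝ} (hw : 0 ≤ w) (hp : p ≠ 0) :
    w ^ (p - 2) * w ^ 2 = w ^ p := by
  rcases hw.eq_or_lt with rfl | hw
  · rw [Real.zero_rpow hp]; norm_num
  · rw [← Real.rpow_natCast, ← Real.rpow_add hw]; norm_num

theorem Real.rpow_sub_two_mul_self {w p : ℝ} (hw : 0 ≤ w) (hp : p ≠ 1) :
    w ^ (p - 2) * w = w ^ (p - 1) := by
  rcases hw.eq_or_lt with rfl | hw
  · rw [Real.zero_rpow (sub_ne_zero.2 hp), mul_zero]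
  · rw [← Real.rpow_add_one hw.ne']; ring_nf

theorem cutoff_energy_density_ge {lam Lam a w η s d κ t p : ℝ} {m : ℕ}
    (hlam : 0 ≤ lam) (ha : lam ≤ a) (ha' : a ≤ Lam) (hw : 0 ≤ w) (hη0 : 0 ≤ η) (hη1 : η ≤ 1)
    (hκ : 0 ≤ κ) (hd : |d| ≤ κ * w) (ht : 0 < t) (hp : 1 < p) (hm : p ≤ m) :
    lam * (η ^ m * w ^ p) - Lam * (t ^ (p - 1) * (m * κ * |s|) ^ p + t⁻¹ * (η ^ m * w ^ p)) ≤
      a * w ^ (p - 2) * (η ^ m * w ^ 2 + m * η ^ (m - 1) * s * d) := by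
  have hY := pow_pred_mul_mul_rpow_le (x := m * κ * |s|) (y := w) hη0 hη1 (by positivity) hw
    ht hp hm
  have hw1 : w ^ (p - 2) * w = w ^ (p - 1) := Real.rpow_sub_two_mul_self hw hp.ne'
  have h1 : a * w ^ (p - 2) * (η ^ m * w ^ 2 + m * η ^ (m - 1) * s * d) =
      a * (η ^ m * w ^ p) + a * (w ^ (p - 2) * (m * η ^ (m - 1) * (s * d))) := by
    rw [← Real.rpow_sub_two_mul_sq hw (by linarith : p ≠ 0)]; ring
  have h2 : -(η ^ (m - 1) * (m * κ * |s|) * w ^ (p - 1)) ≤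
      w ^ (p - 2) * (m * η ^ (m - 1) * (s * d)) := by
    have h3 : -(|s| * (κ * w)) ≤ s * d := by
      have := neg_abs_le (s * d)
      rw [abs_mul] at this
      nlinarith [mul_le_mul_of_nonneg_left hd (abs_nonneg s)]
    have h4 : 0 ≤ w ^ (p - 2) * (m * η ^ (m - 1)) := by positivity
    rw [← hw1]
    nlinarith [mul_le_mul_of_nonneg_left h3 h4]
  have hG : 0 ≤ η ^ m * w ^ p := by positivity
  have hH : 0 ≤ t ^ (p - 1) * (m * κ * |s|) ^ p + t⁻¹ * (η ^ m * w ^ p) := by positivity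
  have ha0 : 0 ≤ a := hlam.trans ha
  rw [h1]
  nlinarith [mul_le_mul_of_nonneg_right ha hG, mul_le_mul_of_nonneg_right ha' hH,
    mul_le_mul_of_nonneg_left (h2.trans' (neg_le_neg hY)) ha0]

/-- The Liouville theorem for quasilinear equations of `p`-Laplace type, on a finite-dimensional
Euclidean space. -/
theorem exists_eq_const_of_weak_solution_of_growth {E : Type*} [NormedAddCommGroup E]
    [InnerProductSpace ℝ E] [FiniteDimensional ℝ E] [MeasurableSpace E] [BorelSpace E]
    (N : ℕ) (hN : 1 ≤ N) (p : Fin N → ℝ) (hp1 : ∀ i, 1 < p i)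
    (lam Lam : ℝ) (hlam : 0 < lam) (hLam : lam ≤ Lam)
    (a : Fin N → E → ℝ → ℝ)
    (ha_meas : ∀ i s, Measurable fun x => a i x s)
    (ha_cont : ∀ i (x : E), Continuous fun s => a i x s)
    (ha_bnd : ∀ i, ∀ᵐ x ∂(volume : Measure (E)),
      ∀ s : ℝ, lam ≤ a i x s ∧ a i x s ≤ Lam)
    (b : E → ℝ → ℝ)
    (hb_meas : ∀ s, Measurable fun x => b x s)
    (hb_cont : ∀ x : E, Continuous fun s => b x s)
    (B : ℝ)
    (hb_bnd : ∀ᵐ x ∂(volume : Measure (E)), ∀ s : ℝ, |b x s| ≤ B)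
    (hb_sign : ∀ᵐ x ∂(volume : Measure (E)), ∀ s : ℝ, 0 ≤ b x s * s)
    (u : E → ℝ) (hu : ContDiff ℝ 1 u)
    (M : ℝ)
    (hu_growth : ∀ r : ℝ, 1 ≤ r →
      ∑ i, r ^ (-(p i)) * ∫ x in ball (0 : E) r \ ball 0 (r / 2),
        |u x| ^ (p i) ≤ M)
    (hu_sol : ∀ v : E → ℝ, ContDiff ℝ (⊤ : ℕ∞) v →
      HasCompactSupport v →
      (∫ x, ∑ i, a i x (u x) * ‖gradient u x‖ ^ (p i - 2) * ⟪gradient u x, gradient v x⟫) +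
      (∫ x, b x (u x) * v x) = 0) :
    ∃ c : ℝ, ∀ x, u x = c := by
  have hlamLam : 0 < Lam := hlam.trans_le hLam
  have hp0 : ∀ i, 0 < p i := fun i => one_pos.trans (hp1 i)
  have hud : Differentiable ℝ u := hu.differentiable one_ne_zero
  have hgc : Continuous (gradient u) :=
    (InnerProductSpace.toDual ℝ _).symm.continuous.comp (hu.continuous_fderiv one_ne_zero)
  obtain ⟨m, hm⟩ : ∃ m : ℕ, ∀ i, p i ≤ m :=
    ⟨∑ i, ⌈p i⌉₊, fun i => (Nat.le_ceil _).trans (by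
      exact_mod_cast Finset.single_le_sum (f := fun i => ⌈p i⌉₊) (fun _ _ => Nat.zero_le _)
        (Finset.mem_univ i))⟩
  have hm2 : 2 ≤ m := by
    have : (1 : ℝ) < m := (hp1 ⟨0, hN⟩).trans_le (hm _)
    exact_mod_cast this
  have hmeas : ∀ f : E → ℝ → ℝ, (∀ s, Measurable fun x => f x s) →
      (∀ x, Continuous fun s => f x s) → Measurable fun x => f x (u x) := fun f h1 h2 =>
    (measurable_uncurry_of_continuous_of_measurable (u := fun s x => f x s) h2 h1).comp
      (hu.continuous.measurable.prodMk measurable_id)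
  let F : E → E := fun x => ∑ i, (a i x (u x) * ‖gradient u x‖ ^ (p i - 2)) • gradient u x
  have hFapply : ∀ (x : E) (ℓ : E →L[ℝ] ℝ), ℓ (F x) =
      ∑ i, a i x (u x) * ‖gradient u x‖ ^ (p i - 2) * ℓ (gradient u x) := by
    intro x ℓ
    simp only [F, map_sum, map_smul, smul_eq_mul]
  have hF : LocallyIntegrable F volume := by
    have hc : Continuous fun x => ∑ i, Lam * ‖gradient u x‖ ^ (p i - 1) :=
      continuous_finsetSum _ fun i _ => continuous_const.mul
        (hgc.norm.rpow_const fun x => Or.inr (by linarith [hp1 i]))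
    refine hc.locallyIntegrable.mono ?_ ?_
    · refine (Finset.measurable_fun_sum _ fun i _ => ?_).aestronglyMeasurable
      exact ((hmeas _ (ha_meas i) (ha_cont i)).mul (hgc.norm.measurable.pow_const _)).smul
        hgc.measurable
    · filter_upwards [ae_all_iff.2 ha_bnd] with x hx
      refine (norm_sum_le _ _).trans (le_trans (Finset.sum_le_sum fun i _ => ?_) (le_abs_self _))
      have h1 := hx i (u x)
      rw [norm_smul, norm_mul, Real.norm_of_nonneg (hlam.le.trans h1.1),
        Real.norm_of_nonneg (by positivity), mul_assoc,
        Real.rpow_sub_two_mul_self (norm_nonneg _) (hp1 i).ne']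
      exact mul_le_mul_of_nonneg_right h1.2 (by positivity)
  have hg : LocallyIntegrable (fun x => b x (u x)) volume := by
    refine (continuous_const (y := B)).locallyIntegrable.mono
      (hmeas _ hb_meas hb_cont).aestronglyMeasurable ?_
    filter_upwards [hb_bnd] with x hx
    exact (hx _).trans (le_abs_self _)
  have hweak : ∀ w : E → ℝ, ContDiff ℝ (⊤ : ℕ∞) w → HasCompactSupport w →
      (∫ x, fderiv ℝ w x (F x)) + (∫ x, b x (u x) * w x) = 0 := by
    intro w hw hwc
    rw [← hu_sol w hw hwc]
    congr 1
    refine integral_congr_ae (Filter.Eventually.of_forall fun x => ?_)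
    simp only [hFapply, ← inner_gradient_left, real_inner_comm]
  set G : E → ℝ := fun x => ∑ i, ‖gradient u x‖ ^ p i with hGdef
  have hGc : Continuous G := continuous_finsetSum _ fun i _ =>
    hgc.norm.rpow_const fun x => Or.inr (hp0 i).le
  have hG0 : ∀ x, 0 ≤ G x := fun x => Finset.sum_nonneg fun i _ => by positivity
  obtain ⟨C, hC0, hcut⟩ := exists_cutoff_of_norm_fderiv_le E
  set T : ℝ → ℝ := fun t => Lam * ∑ i, t ^ (p i - 1) * ((m * C) ^ p i * M) with hTdef
  have hT : Filter.Tendsto T (nhdsWithin 0 (Set.Ioi 0)) (nhds 0) := by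
    have hTc : Continuous T := continuous_const.mul (continuous_finsetSum _ fun i _ =>
      (Real.continuous_rpow_const (by linarith [hp1 i])).mul continuous_const)
    have hT0 : T 0 = 0 := by
      simp only [hTdef]
      rw [Finset.sum_eq_zero, mul_zero]
      intro i _
      rw [Real.zero_rpow (by linarith [hp1 i]), zero_mul]
    have := hTc.tendsto 0
    rw [hT0] at this
    exact this.mono_left nhdsWithin_le_nhds
  have hGzero : ∀ x, G x = 0 := by
    refine continuous_eq_zero_of_cutoff_energy_le volume hGc hG0 hlam hlamLam hT fun r hr => ?_
    have hr0 : 0 < r := one_pos.trans_le hr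
    obtain ⟨η, hη, hηc, hη0, hη1, hηone, hηzero, hηd, hηd0⟩ := hcut r hr0
    refine ⟨fun x => η x ^ m, hη.continuous.pow m, fun x => pow_nonneg (hη0 x) m,
      fun x => pow_le_one₀ (hη0 x) (hη1 x), fun x hx => by simp only [hηone x hx, one_pow],
      fun x hx => by simp only [hηzero x hx]; exact zero_pow (by omega), fun t ht => ?_⟩
    set v : E → ℝ := fun x => η x ^ m * u x with hvdef
    have hv : ContDiff ℝ 1 v := (hη.pow m).mul hu
    have hvc : HasCompactSupport v :=
      HasCompactSupport.intro (isCompact_closedBall (0 : E) r) fun x hx => by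
        simp only [hvdef, hηzero x fun h => hx (ball_subset_closedBall h)]
        rw [zero_pow (by omega), zero_mul]
    have hvd : ∀ x, fderiv ℝ v x (gradient u x) = η x ^ m * ‖gradient u x‖ ^ 2 +
        m * η x ^ (m - 1) * u x * fderiv ℝ η x (gradient u x) := by
      intro x
      have h1 := (((hη.differentiable one_ne_zero x).hasFDerivAt).pow m).mul (hud x).hasFDerivAt
      rw [show fderiv ℝ v x = _ from h1.fderiv]
      have h2 : fderiv ℝ u x (gradient u x) = ‖gradient u x‖ ^ 2 := by
        rw [← inner_gradient_left, real_inner_self_eq_norm_sq]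
      simp [h2]
      ring
    obtain ⟨hi1, hi2, hzero⟩ :=
      integral_fderiv_apply_add_eq_zero_of_smooth volume hF hg hweak hv hvc
    set A : Set E := ball (0 : E) r \ ball 0 (r / 2) with hA
    have hAm : MeasurableSet A := measurableSet_ball.diff measurableSet_ball
    have hint : ∀ f : E → ℝ, Continuous f → IntegrableOn f (ball (0 : E) r) := fun f hf =>
      (hf.locallyIntegrable.integrableOn_isCompact (isCompact_closedBall 0 r)).mono_set
        ball_subset_closedBall
    have hup : ∀ i, Continuous fun x => |u x| ^ p i := fun i =>
      hu.continuous.abs.rpow_const fun x => Or.inr (hp0 i).le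
    set H : E → ℝ := fun x => ∑ i, t ^ (p i - 1) * ((m * C) ^ p i * (r ^ (-p i) * |u x| ^ p i))
      with hHdef
    have hHc : Continuous H := continuous_finsetSum _ fun i _ =>
      continuous_const.mul (continuous_const.mul (continuous_const.mul (hup i)))
    have hφG : Continuous fun x => η x ^ m * G x := (hη.continuous.pow m).mul hGc
    have hHint : Lam * ∫ x in A, H x ≤ T t := by
      refine mul_le_mul_of_nonneg_left ?_ hlamLam.le
      rw [integral_finsetSum _ fun i _ => ((((hint _ (hup i)).mono_set
        Set.sdiff_subset).const_mul _).const_mul _).const_mul _]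
      refine Finset.sum_le_sum fun i _ => ?_
      rw [integral_const_mul, integral_const_mul, integral_const_mul]
      have h1 : r ^ (-p i) * ∫ x in A, |u x| ^ p i ≤ M := by
        refine le_trans ?_ (hu_growth r hr)
        refine Finset.single_le_sum
          (f := fun i => r ^ (-(p i)) * ∫ x in ball (0 : E) r \ ball 0 (r / 2), |u x| ^ (p i))
          (fun j _ => ?_) (Finset.mem_univ i)
        exact mul_nonneg (by positivity) (integral_nonneg fun x => by positivity)
      gcongr
    have hHterm : ∀ x i, t ^ (p i - 1) * (m * (C / r) * |u x|) ^ p i =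
        t ^ (p i - 1) * ((m * C) ^ p i * (r ^ (-p i) * |u x| ^ p i)) := by
      intro x i
      rw [Real.rpow_neg hr0.le, ← Real.inv_rpow hr0.le, ← Real.mul_rpow (by positivity)
        (by positivity), ← Real.mul_rpow (by positivity) (by positivity)]
      congr 2
      field_simp
    have hpt : ∀ᵐ x ∂(volume.restrict (ball (0 : E) r)),
        lam * (η x ^ m * G x) - A.indicator (fun x => Lam * H x + Lam * t⁻¹ * (η x ^ m * G x)) x ≤
        fderiv ℝ v x (F x) + b x (u x) * v x := by
      rw [ae_restrict_iff' measurableSet_ball]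
      filter_upwards [ae_all_iff.2 ha_bnd, hb_sign] with x hx hbx hxr
      have hb0 : 0 ≤ b x (u x) * v x := by
        have := mul_nonneg (hbx (u x)) (pow_nonneg (hη0 x) m)
        simp only [hvdef]
        linarith
      refine le_add_of_le_of_nonneg ?_ hb0
      rw [hFapply, hvd]
      by_cases hxA : x ∈ A
      · rw [Set.indicator_of_mem hxA]
        have hsum : lam * (η x ^ m * G x) - (Lam * H x + Lam * t⁻¹ * (η x ^ m * G x)) =
            ∑ i, (lam * (η x ^ m * ‖gradient u x‖ ^ p i) -
              Lam * (t ^ (p i - 1) * (m * (C / r) * |u x|) ^ p i +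
                t⁻¹ * (η x ^ m * ‖gradient u x‖ ^ p i))) := by
          simp only [hHterm]
          simp only [hHdef, hGdef, Finset.sum_sub_distrib, Finset.mul_sum, mul_add,
            Finset.sum_add_distrib, mul_assoc]
        rw [hsum]
        refine Finset.sum_le_sum fun i _ => ?_
        refine cutoff_energy_density_ge hlam.le (hx i _).1 (hx i _).2 (norm_nonneg _) (hη0 x)
          (hη1 x) (by positivity) ?_ ht (hp1 i) (hm i)
        exact ((fderiv ℝ η x).le_opNorm _).trans
          (mul_le_mul_of_nonneg_right (hηd x) (norm_nonneg _))
      · rw [Set.indicator_of_notMem hxA, sub_zero]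
        have hx2 : x ∈ ball (0 : E) (r / 2) := by
          by_contra hcon
          exact hxA ⟨hxr, hcon⟩
        simp only [hGdef, Finset.mul_sum]
        refine Finset.sum_le_sum fun i _ => ?_
        rw [hηd0 x hx2, zero_apply, mul_zero, add_zero,
          ← Real.rpow_sub_two_mul_sq (norm_nonneg (gradient u x)) (hp0 i).ne']
        have h1 : 0 ≤ η x ^ m * (‖gradient u x‖ ^ (p i - 2) * ‖gradient u x‖ ^ 2) :=
          mul_nonneg (pow_nonneg (hη0 x) m) (by positivity)
        nlinarith [mul_le_mul_of_nonneg_right (hx i (u x)).1 h1]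
    have hsol : ∫ x in ball (0 : E) r, (fderiv ℝ v x (F x) + b x (u x) * v x) = 0 := by
      rw [← hzero, ← integral_add hi1 hi2]
      refine setIntegral_eq_integral_of_forall_compl_eq_zero fun x hx => ?_
      have h1 : η x = 0 := hηzero x hx
      rw [hFapply, hvd]
      simp only [hvdef, h1]
      rw [zero_pow (by omega), zero_pow (by omega)]
      simp
    have hRc : Continuous fun x => Lam * H x + Lam * t⁻¹ * (η x ^ m * G x) :=
      (continuous_const.mul hHc).add (continuous_const.mul hφG)
    have hmono := integral_mono_ae
      (((hint _ hφG).const_mul lam).sub ((hint _ hRc).indicator hAm))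
      (hi1.add hi2).integrableOn hpt
    have hAA : ball (0 : E) r ∩ A = A := Set.inter_eq_right.2 Set.sdiff_subset
    simp only [Pi.sub_apply, Pi.add_apply] at hmono
    rw [hsol, integral_sub ((hint _ hφG).const_mul lam) ((hint _ hRc).indicator hAm),
      setIntegral_indicator hAm, hAA, integral_const_mul, integral_add
      (((hint _ hHc).mono_set Set.sdiff_subset).const_mul _)
      (((hint _ hφG).mono_set Set.sdiff_subset).const_mul _),
      integral_const_mul, integral_const_mul] at hmono
    linarith
  refine ⟨u 0, fun x => is_const_of_fderiv_eq_zero hud (fun y => ?_) x 0⟩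
  have h1 := (Finset.sum_eq_zero_iff_of_nonneg fun i _ => by positivity).1 (hGzero y) ⟨0, hN⟩
    (Finset.mem_univ _)
  have h2 : gradient u y = 0 :=
    norm_eq_zero.1 ((Real.rpow_eq_zero (norm_nonneg _) (hp0 _).ne').1 h1)
  rw [← toDual_gradient, h2, map_zero]

/-- Liouville theorem under the integral growth condition (2.16): if a solution `u` of
`-∂_k (∑ i, a i (x, u) |∇u|^(pᵢ-2) ∂_k u) + b (x, u) = 0` in `ℝⁿ` satisfies
`∑ i, r^(-pᵢ) ∫_{B_r \ B_{r/2}} |u|^(pᵢ) ≤ M` for all `r ≥ 1`, then `u` is constant. -/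
theorem liouville_p_laplace_type_growth_condition
    (n N : ℕ) (hn : 1 ≤ n) (hN : 1 ≤ N)
    (p : Fin N → ℝ) (hp_mono : Monotone p) (hp1 : ∀ i, 1 < p i)
    (lam Lam : ℝ) (hlam : 0 < lam) (hLam : lam ≤ Lam)
    (a : Fin N → EuclideanSpace ℝ (Fin n) → ℝ → ℝ)
    (ha_meas : ∀ i s, Measurable fun x => a i x s)
    (ha_cont : ∀ i (x : EuclideanSpace ℝ (Fin n)), Continuous fun s => a i x s)
    (ha_bnd : ∀ i, ∀ᵐ x ∂(volume : Measure (EuclideanSpace ℝ (Fin n))),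
      ∀ s : ℝ, lam ≤ a i x s ∧ a i x s ≤ Lam)
    (b : EuclideanSpace ℝ (Fin n) → ℝ → ℝ)
    (hb_meas : ∀ s, Measurable fun x => b x s)
    (hb_cont : ∀ x : EuclideanSpace ℝ (Fin n), Continuous fun s => b x s)
    (B : ℝ)
    (hb_bnd : ∀ᵐ x ∂(volume : Measure (EuclideanSpace ℝ (Fin n))), ∀ s : ℝ, |b x s| ≤ B)
    (hb_sign : ∀ᵐ x ∂(volume : Measure (EuclideanSpace ℝ (Fin n))), ∀ s : ℝ, 0 ≤ b x s * s)
    (u : EuclideanSpace ℝ (Fin n) → ℝ) (hu : ContDiff ℝ 1 u)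
    (M : ℝ) (hM : 0 < M)
    (hu_growth : ∀ r : ℝ, 1 ≤ r →
      ∑ i, r ^ (-(p i)) * ∫ x in ball (0 : EuclideanSpace ℝ (Fin n)) r \ ball 0 (r / 2),
        |u x| ^ (p i) ≤ M)
    (hu_sol : ∀ v : EuclideanSpace ℝ (Fin n) → ℝ, ContDiff ℝ (⊤ : ℕ∞) v →
      HasCompactSupport v →
      (∫ x, ∑ i, a i x (u x) * ‖gradient u x‖ ^ (p i - 2) * ⟪gradient u x, gradient v x⟫) +
      (∫ x, b x (u x) * v x) = 0) :
    ∃ c : ℝ, ∀ x, u x = c := by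
  exact exists_eq_const_of_weak_solution_of_growth N hN p hp1 lam Lam hlam hLam a ha_meas ha_cont
    ha_bnd b hb_meas hb_cont B hb_bnd hb_sign u hu M hu_growth hu_sol
end

section
/- Finiteness of the energies under condition (2.16): let n ≥ 1, N ≥ 1, real exponents 1 < p₁ ≤ ⋯ ≤ p_N, let a_i : ℝⁿ × ℝ → ℝ satisfy λ ≤ a_i(x,s) ≤ Λ with 0 < λ ≤ Λ, and let b : ℝⁿ × ℝ → ℝ be bounded with b(x,s)·s ≥ 0. Suppose u is a solution of -∂_{x_k}(∑_{i=1}^N a_i(x,u)|∇u|^{p_i−2} ∂_{x_k} u) + b(x,u) = 0 in ℝⁿ such that there exists M > 0 with ∑_{i=1}^N r^{−p_i} ∫_{B_r \ B_{r/2}} |u|^{p_i} dx ≤ M for every r ≥ 1. Then for each i = 1,…,N the integral ∫_{ℝⁿ} |∇u|^{p_i} dx is finite, i.e. ∫_{B_r} |∇u|^{p_i} dx is bounded independently of r. -/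
open MeasureTheory Metric
open scoped RealInnerProductSpace

section Approximation

variable {E : Type*} [NormedAddCommGroup E] [NormedSpace ℝ E] [FiniteDimensional ℝ E]
  [MeasurableSpace E] [BorelSpace E]

open scoped Pointwise in
/-- A compactly supported `C¹` function is a `C¹`-uniform limit of smooth functions supported in a
common compact set. -/
theorem exists_contDiff_approx_C1 {v : E → ℝ} (hv : ContDiff ℝ 1 v) (hvc : HasCompactSupport v) :
    ∃ K : Set E, IsCompact K ∧ tsupport v ⊆ K ∧ ∀ ε > 0, ∃ w : E → ℝ,
      ContDiff ℝ (⊤ : ℕ∞) w ∧ tsupport w ⊆ K ∧ (∀ x, |w x - v x| ≤ ε) ∧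
        ∀ x, ‖fderiv ℝ w x - fderiv ℝ v x‖ ≤ ε := by
  have hK : IsCompact (closedBall (0 : E) 1 + tsupport v) :=
    (isCompact_closedBall 0 1).add hvc
  refine ⟨closedBall (0 : E) 1 + tsupport v, hK, ?_, fun ε hε => ?_⟩
  · intro x hx
    exact ⟨0, by simp, x, hx, by simp⟩
  let μ : Measure E := Measure.addHaar
  have hdc : Continuous (fderiv ℝ v) := hv.continuous_fderiv one_ne_zero
  obtain ⟨δ₁, hδ₁, h₁⟩ := Metric.uniformContinuous_iff.1
    (hv.continuous.uniformContinuous_of_tendsto_cocompact hvc.is_zero_at_infty) ε hε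
  obtain ⟨δ₂, hδ₂, h₂⟩ := Metric.uniformContinuous_iff.1
    (hdc.uniformContinuous_of_tendsto_cocompact (hvc.fderiv ℝ).is_zero_at_infty) ε hε
  let δ := min 1 (min δ₁ δ₂)
  have hδ : 0 < δ := by positivity
  let φ : ContDiffBump (0 : E) := ⟨δ / 2, δ, by positivity, by linarith⟩
  have hφc : HasCompactSupport (φ.normed μ) := φ.hasCompactSupport_normed
  have hφi : LocallyIntegrable (φ.normed μ) μ := φ.continuous_normed.locallyIntegrable
  refine ⟨convolution (φ.normed μ) v (ContinuousLinearMap.lsmul ℝ ℝ) μ,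
    hφc.contDiff_convolution_left _ φ.contDiff_normed hv.continuous.locallyIntegrable,
    ?_, fun x => ?_, fun x => ?_⟩
  · refine closure_minimal ((support_convolution_subset _).trans ?_) hK.isClosed
    refine Set.add_subset_add ?_ (subset_tsupport v)
    rw [φ.support_normed_eq]
    exact ball_subset_closedBall.trans (closedBall_subset_closedBall (min_le_left _ _))
  · rw [← Real.dist_eq]
    refine φ.dist_normed_convolution_le hv.continuous.aestronglyMeasurable fun y hy => ?_
    exact (h₁ ((mem_ball.1 hy).trans_le ((min_le_right _ _).trans (min_le_left _ _)))).le
  · have hder := hvc.hasFDerivAt_convolution_right (ContinuousLinearMap.lsmul ℝ ℝ) hφi hv x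
    have heq : convolution (φ.normed μ) (fderiv ℝ v)
        ((ContinuousLinearMap.lsmul ℝ ℝ : ℝ →L[ℝ] ℝ →L[ℝ] ℝ).precompR E) μ x =
        convolution (φ.normed μ) (fderiv ℝ v) (ContinuousLinearMap.lsmul ℝ ℝ) μ x := by
      refine integral_congr_ae (Filter.Eventually.of_forall fun t => ?_)
      ext y
      simp
    rw [hder.fderiv, heq, ← dist_eq_norm]
    refine φ.dist_normed_convolution_le hdc.aestronglyMeasurable fun y hy => ?_
    exact (h₂ ((mem_ball.1 hy).trans_le ((min_le_right _ _).trans (min_le_right _ _)))).le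

theorem integrable_fderiv_apply {μ : Measure E} {F : E → E} (hF : LocallyIntegrable F μ)
    {w : E → ℝ} (hw : ContDiff ℝ 1 w) (hwc : HasCompactSupport w) :
    Integrable (fun x => fderiv ℝ w x (F x)) μ := by
  have hdw := hw.continuous_fderiv one_ne_zero
  have hFn : LocallyIntegrable (fun x => ‖F x‖) μ := fun x => (hF x).norm
  refine (hFn.integrable_smul_left_of_hasCompactSupport hdw.norm (hwc.fderiv ℝ).norm).mono' ?_
    (Filter.Eventually.of_forall fun x => (fderiv ℝ w x).le_opNorm (F x))
  exact (ContinuousLinearMap.id ℝ (E →L[ℝ] ℝ)).aestronglyMeasurable_comp₂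
    hdw.aestronglyMeasurable hF.aestronglyMeasurable

/-- A first-order integral identity valid for smooth compactly supported test functions extends
to `C¹` compactly supported test functions. -/
theorem integral_fderiv_add_integral_eq_zero_of_contDiff_one {μ : Measure E}
    {F : E → E} {G : E → ℝ} (hF : LocallyIntegrable F μ) (hG : LocallyIntegrable G μ)
    (h : ∀ w : E → ℝ, ContDiff ℝ (⊤ : ℕ∞) w → HasCompactSupport w →
      ∫ x, fderiv ℝ w x (F x) + G x * w x ∂μ = 0)
    {v : E → ℝ} (hv : ContDiff ℝ 1 v) (hvc : HasCompactSupport v) :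
    ∫ x, fderiv ℝ v x (F x) + G x * v x ∂μ = 0 := by
  obtain ⟨K, hK, hvK, happ⟩ := exists_contDiff_approx_C1 hv hvc
  have hint : ∀ w : E → ℝ, ContDiff ℝ 1 w → HasCompactSupport w →
      Integrable (fun x => fderiv ℝ w x (F x) + G x * w x) μ := by
    intro w hw hwc
    refine Integrable.add ?_ ?_
    · exact integrable_fderiv_apply hF hw hwc
    · exact hG.integrable_smul_right_of_hasCompactSupport hw.continuous hwc
  have hFK : IntegrableOn (fun x => ‖F x‖ + |G x|) K μ :=
    (hF.integrableOn_isCompact hK).norm.add (hG.integrableOn_isCompact hK).norm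
  have hnn : 0 ≤ ∫ x in K, ‖F x‖ + |G x| ∂μ := integral_nonneg fun x => by positivity
  refine abs_eq_zero.1 (le_antisymm (le_of_forall_pos_le_add fun ε hε => ?_) (abs_nonneg _))
  set I := ∫ x in K, ‖F x‖ + |G x| ∂μ
  have hη : 0 < ε / (I + 1) := by positivity
  obtain ⟨w, hw, hwK, hw0, hw1⟩ := happ _ hη
  have hwc : HasCompactSupport w := hK.of_isClosed_subset (isClosed_tsupport w) hwK
  have hw' : ContDiff ℝ 1 w := hw.of_le (by exact_mod_cast le_top)
  have hzero : ∀ x ∉ K, fderiv ℝ v x (F x) + G x * v x -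
      (fderiv ℝ w x (F x) + G x * w x) = 0 := by
    intro x hx
    have hxv : x ∉ tsupport v := fun h => hx (hvK h)
    have hxw : x ∉ tsupport w := fun h => hx (hwK h)
    rw [image_eq_zero_of_notMem_tsupport hxv, image_eq_zero_of_notMem_tsupport hxw,
      fderiv_of_notMem_tsupport ℝ hxv, fderiv_of_notMem_tsupport ℝ hxw]
    simp
  have hdiff : ∫ x, fderiv ℝ v x (F x) + G x * v x ∂μ = ∫ x in K, fderiv ℝ v x (F x) + G x * v x -
      (fderiv ℝ w x (F x) + G x * w x) ∂μ := by
    rw [setIntegral_eq_integral_of_forall_compl_eq_zero hzero,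
      integral_sub (hint v hv hvc) (hint w hw' hwc), h w hw hwc, sub_zero]
  rw [hdiff, ← Real.norm_eq_abs]
  calc _ ≤ ∫ x in K, ε / (I + 1) * (‖F x‖ + |G x|) ∂μ := by
        refine norm_integral_le_of_norm_le (hFK.const_mul _)
          (Filter.Eventually.of_forall fun x => ?_)
        have e : fderiv ℝ v x (F x) + G x * v x - (fderiv ℝ w x (F x) + G x * w x) =
            -((fderiv ℝ w x - fderiv ℝ v x) (F x) + G x * (w x - v x)) := by
          rw [sub_apply]; ring
        rw [e, norm_neg]
        calc _ ≤ ‖(fderiv ℝ w x - fderiv ℝ v x) (F x)‖ + ‖G x * (w x - v x)‖ := norm_add_le _ _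
          _ ≤ ε / (I + 1) * ‖F x‖ + |G x| * (ε / (I + 1)) := by
            gcongr
            · exact (ContinuousLinearMap.le_opNorm _ _).trans (by gcongr; exact hw1 x)
            · rw [norm_mul, Real.norm_eq_abs, Real.norm_eq_abs]
              gcongr
              exact hw0 x
          _ = _ := by ring
    _ = ε / (I + 1) * I := integral_const_mul _ _
    _ ≤ 0 + ε := by
      rw [zero_add, div_mul_eq_mul_div, div_le_iff₀ (by positivity)]
      nlinarith

end Approximation

/-- Pointwise absorption inequality for the cross term in the Caccioppoli estimate. -/
theorem mul_rpow_mul_le_absorb {p A h w c d : ℝ} {q : ℕ} (hp : 1 < p) (hpq : p ≤ q) (hA : 0 ≤ A)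
    (hh : 0 ≤ h) (hh1 : h ≤ 1) (hw : 0 ≤ w) (hc : 0 ≤ c) (hd : 0 < d) :
    c * (A ^ (p - 1) * h ^ (q - 1) * w) ≤
      d * (A ^ p * h ^ q) + c * (c / d) ^ (p - 1) * w ^ p := by
  have hq : 1 < q := by exact_mod_cast hp.trans_le hpq
  have hsplit : ∀ z : ℝ, 0 ≤ z → z ^ p = z ^ (p - 1) * z := fun z hz => by
    rw [← Real.rpow_add_one' hz (by linarith)]; ring_nf
  have hhq : h ^ q = h ^ (q - 1) * h := (pow_sub_one_mul (by omega) h).symm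
  rcases le_total (c * w) (d * (A * h)) with hcase | hcase
  · have h1 : c * (A ^ (p - 1) * h ^ (q - 1) * w) ≤ d * (A ^ p * h ^ q) := by
      calc _ = A ^ (p - 1) * h ^ (q - 1) * (c * w) := by ring
        _ ≤ A ^ (p - 1) * h ^ (q - 1) * (d * (A * h)) := by gcongr
        _ = _ := by rw [hsplit A hA, hhq]; ring
    have : 0 ≤ c * (c / d) ^ (p - 1) * w ^ p := by positivity
    linarith
  · have hAh : A * h ≤ c / d * w := by
      rw [div_mul_eq_mul_div, le_div_iff₀ hd]; linarith
    have h1 : h ^ (q - 1) ≤ h ^ (p - 1) := by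
      rw [← Real.rpow_natCast, Nat.cast_sub hq.le, Nat.cast_one]
      exact Real.rpow_le_rpow_of_exponent_ge_of_imp hh hh1 (by linarith)
        (fun _ h0 => by linarith)
    have h2 : A ^ (p - 1) * h ^ (q - 1) ≤ (c / d) ^ (p - 1) * w ^ (p - 1) := by
      calc _ ≤ A ^ (p - 1) * h ^ (p - 1) := by gcongr
        _ = (A * h) ^ (p - 1) := (Real.mul_rpow hA hh).symm
        _ ≤ (c / d * w) ^ (p - 1) := by gcongr
        _ = _ := Real.mul_rpow (by positivity) hw
    have : 0 ≤ d * (A ^ p * h ^ q) := by positivity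
    calc _ ≤ c * ((c / d) ^ (p - 1) * w ^ (p - 1) * w) := by gcongr
      _ = c * (c / d) ^ (p - 1) * w ^ p := by rw [hsplit w hw]; ring
      _ ≤ _ := by linarith

/-- Cutoff functions between concentric balls of radii `R / 2` and `R`, with derivative of
size `1 / R`. -/
theorem exists_cutoff_ball (E : Type*) [NormedAddCommGroup E] [NormedSpace ℝ E]
    [FiniteDimensional ℝ E] :
    ∃ c : ℝ, 0 ≤ c ∧ ∀ R : ℝ, 0 < R → ∃ η : E → ℝ, ContDiff ℝ 1 η ∧ HasCompactSupport η ∧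
      (∀ x, 0 ≤ η x) ∧ (∀ x, η x ≤ 1) ∧ (∀ x ∈ ball (0 : E) (R / 2), η x = 1) ∧
      (∀ x, ‖fderiv ℝ η x‖ ≤ c * R⁻¹) ∧
      ∀ x ∉ ball (0 : E) R \ ball 0 (R / 2), fderiv ℝ η x = 0 := by
  let φ : ContDiffBump (0 : E) := ⟨1 / 2, 3 / 4, by norm_num, by norm_num⟩
  have hφ : ContDiff ℝ 1 φ := φ.contDiff
  obtain ⟨c, hc⟩ := (hφ.continuous_fderiv one_ne_zero).bounded_above_of_compact_support
    (φ.hasCompactSupport.fderiv ℝ)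
  refine ⟨c, (norm_nonneg _).trans (hc 0), fun R hR => ?_⟩
  have hder : ∀ x, fderiv ℝ (fun x => φ (R⁻¹ • x)) x = R⁻¹ • fderiv ℝ φ (R⁻¹ • x) :=
    fun x => fderiv_comp_smul _
  have hnorm : ∀ x : E, ‖R⁻¹ • x‖ = ‖x‖ / R := fun x => by
    rw [norm_smul, Real.norm_of_nonneg (by positivity), div_eq_inv_mul]
  have hone : ∀ x ∈ ball (0 : E) (R / 2), φ (R⁻¹ • x) = 1 := fun x hx => by
    refine φ.one_of_mem_closedBall ?_
    rw [mem_closedBall_zero_iff, hnorm, div_le_iff₀ hR]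
    rw [mem_ball_zero_iff] at hx
    change ‖x‖ ≤ 1 / 2 * R
    linarith
  refine ⟨fun x => φ (R⁻¹ • x), hφ.comp (contDiff_const_smul _),
    φ.hasCompactSupport.comp_smul (inv_ne_zero hR.ne'), fun _ => φ.nonneg, fun _ => φ.le_one,
    hone, fun x => ?_, fun x hx => ?_⟩
  · rw [hder, norm_smul, Real.norm_of_nonneg (by positivity), mul_comm]
    gcongr
    exact hc _
  · by_cases hx2 : x ∈ ball (0 : E) (R / 2)
    · have : (fun x => φ (R⁻¹ • x)) =ᶠ[nhds x] fun _ => (1 : ℝ) :=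
        Filter.mem_of_superset (isOpen_ball.mem_nhds hx2) hone
      rw [this.fderiv_eq]
      simp
    · have hxR : x ∉ ball (0 : E) R := fun h => hx ⟨h, hx2⟩
      rw [hder, fderiv_of_notMem_tsupport ℝ, smul_zero]
      rw [φ.tsupport_eq, mem_closedBall_zero_iff, hnorm, not_le, lt_div_iff₀ hR]
      rw [mem_ball_zero_iff, not_lt] at hxR
      change 3 / 4 * R < ‖x‖
      linarith

/-- Composing a Carathéodory function with a continuous function gives a measurable function. -/
theorem measurable_caratheodory_comp {E : Type*} [TopologicalSpace E] [MeasurableSpace E]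
    [BorelSpace E] {f : E → ℝ → ℝ} (hf_meas : ∀ s, Measurable fun x => f x s)
    (hf_cont : ∀ x, Continuous fun s => f x s) {u : E → ℝ} (hu : Continuous u) :
    Measurable fun x => f x (u x) :=
  (measurable_uncurry_of_continuous_of_measurable (u := fun s x => f x s) hf_cont hf_meas).comp
    (hu.measurable.prodMk measurable_id)

theorem ContDiff.continuous_gradient {E : Type*} [NormedAddCommGroup E] [InnerProductSpace ℝ E]
    [CompleteSpace E] {u : E → ℝ} (hu : ContDiff ℝ 1 u) :
    Continuous (gradient u) :=
  (InnerProductSpace.toDual ℝ E).symm.continuous.comp (hu.continuous_fderiv one_ne_zero)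

/-- Lower bound for one term of the equation tested against `u * η ^ q`. -/
theorem coercive_sub_le_test_term {E : Type*} [NormedAddCommGroup E] [NormedSpace ℝ E]
    {p lam Lam α : ℝ} {q : ℕ} (hp : 1 < p) (hpq : p ≤ q)
    (hlam : 0 < lam) (hα : lam ≤ α) (hα' : α ≤ Lam) (y : E) {h s : ℝ} (hh : 0 ≤ h) (hh1 : h ≤ 1)
    (L : E →L[ℝ] ℝ) :
    lam / 2 * (‖y‖ ^ p * h ^ q) -
        Lam * q * (Lam * q / (lam / 2)) ^ (p - 1) * (|s| * ‖L‖) ^ p ≤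
      α * ‖y‖ ^ (p - 2) * (h ^ q * ‖y‖ ^ 2 + s * (q * h ^ (q - 1) * L y)) := by
  have hLam : 0 ≤ Lam := hlam.le.trans (hα.trans hα')
  have hp0 : 0 < p := by linarith
  have e1 : ‖y‖ ^ (p - 2) * ‖y‖ ^ 2 = ‖y‖ ^ p := by
    rw [← Real.rpow_natCast, ← Real.rpow_add' (norm_nonneg y) (by push_cast; linarith)]
    congr 1; push_cast; ring
  have e2 : ‖y‖ ^ (p - 2) * |L y| ≤ ‖y‖ ^ (p - 1) * ‖L‖ := by
    calc _ ≤ ‖y‖ ^ (p - 2) * (‖L‖ * ‖y‖) := by gcongr; exact L.le_opNorm y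
      _ = ‖y‖ ^ (p - 2 + 1) * ‖L‖ := by
        rw [Real.rpow_add_one' (norm_nonneg y) (by linarith)]; ring
      _ = _ := by ring_nf
  have key := mul_rpow_mul_le_absorb (c := Lam * q) (d := lam / 2) (w := |s| * ‖L‖) hp hpq
    (norm_nonneg y) hh hh1 (by positivity) (by positivity) (by positivity)
  have h1 : lam * (‖y‖ ^ p * h ^ q) ≤ α * (‖y‖ ^ p * h ^ q) := by gcongr
  have h2 : |α * ‖y‖ ^ (p - 2) * (s * (q * h ^ (q - 1) * L y))| ≤
      Lam * q * (‖y‖ ^ (p - 1) * h ^ (q - 1) * (|s| * ‖L‖)) := by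
    have hα0 : 0 ≤ α := hlam.le.trans hα
    have hy : 0 ≤ ‖y‖ ^ (p - 2) := by positivity
    rw [abs_mul, abs_mul, abs_mul, abs_mul, abs_mul, abs_of_nonneg hα0, abs_of_nonneg hy,
      abs_of_nonneg (pow_nonneg hh _), Nat.abs_cast]
    calc _ = α * (q * |s| * h ^ (q - 1) * (‖y‖ ^ (p - 2) * |L y|)) := by ring
      _ ≤ Lam * (q * |s| * h ^ (q - 1) * (‖y‖ ^ (p - 1) * ‖L‖)) := by gcongr
      _ = _ := by ring
  have h3 : α * ‖y‖ ^ (p - 2) * (h ^ q * ‖y‖ ^ 2 + s * (q * h ^ (q - 1) * L y)) =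
      α * (‖y‖ ^ p * h ^ q) + α * ‖y‖ ^ (p - 2) * (s * (q * h ^ (q - 1) * L y)) := by
    rw [← e1]; ring
  rw [h3]
  linarith [neg_abs_le (α * ‖y‖ ^ (p - 2) * (s * (q * h ^ (q - 1) * L y)))]

/-- Caccioppoli inequality for a weak `C¹` solution of
`-div (∑ i, α i |∇u|^(pᵢ-2) ∇u) + β = 0` with `β * u ≥ 0`. -/
theorem caccioppoli_of_weak_solution {E : Type*} [NormedAddCommGroup E] [InnerProductSpace ℝ E]
    [FiniteDimensional ℝ E] [MeasurableSpace E] [BorelSpace E]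
    {μ : Measure E} [IsLocallyFiniteMeasure μ] {ι : Type*} [Fintype ι]
    {p : ι → ℝ} (hp : ∀ i, 1 < p i) {q : ℕ} (hpq : ∀ i, p i ≤ q) (hq : q ≠ 0)
    {lam Lam : ℝ} (hlam : 0 < lam)
    {α : ι → E → ℝ} (hα_meas : ∀ i, Measurable (α i))
    (hα : ∀ i, ∀ᵐ x ∂μ, lam ≤ α i x ∧ α i x ≤ Lam)
    {β : E → ℝ} (hβ_meas : Measurable β) {B : ℝ} (hβ : ∀ᵐ x ∂μ, |β x| ≤ B)
    {u : E → ℝ} (hβu : ∀ᵐ x ∂μ, 0 ≤ β x * u x) (hu : ContDiff ℝ 1 u)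
    (hsol : ∀ v : E → ℝ, ContDiff ℝ (⊤ : ℕ∞) v → HasCompactSupport v →
      (∫ x, ∑ i, α i x * ‖gradient u x‖ ^ (p i - 2) * ⟪gradient u x, gradient v x⟫ ∂μ) +
      (∫ x, β x * v x ∂μ) = 0)
    {η : E → ℝ} (hη : ContDiff ℝ 1 η) (hηc : HasCompactSupport η) (hη0 : ∀ x, 0 ≤ η x)
    (hη1 : ∀ x, η x ≤ 1) :
    lam / 2 * ∑ i, ∫ x, ‖gradient u x‖ ^ p i * η x ^ q ∂μ ≤
      ∑ i, Lam * q * (Lam * q / (lam / 2)) ^ (p i - 1) *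
        ∫ x, (|u x| * ‖fderiv ℝ η x‖) ^ p i ∂μ := by
  have hg := hu.continuous_gradient
  have hdη := hη.continuous_fderiv one_ne_zero
  let F : E → E := fun x => ∑ i, (α i x * ‖gradient u x‖ ^ (p i - 2)) • gradient u x
  have hF_meas : Measurable F := by
    refine Finset.measurable_fun_sum _ fun i _ => ?_
    exact ((hα_meas i).mul (hg.norm.measurable.pow_const _)).smul hg.measurable
  have hF : LocallyIntegrable F μ := by
    have hbd : Continuous fun x => ∑ i, Lam * ‖gradient u x‖ ^ (p i - 1) :=
      continuous_finsetSum _ fun i _ => continuous_const.mul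
        (hg.norm.rpow_const fun _ => Or.inr (by linarith [hp i]))
    refine hbd.locallyIntegrable.mono hF_meas.aestronglyMeasurable ?_
    filter_upwards [ae_all_iff.2 hα] with x hx
    refine (norm_sum_le _ _).trans ((Finset.sum_le_sum fun i _ => ?_).trans (le_abs_self _))
    have hy : 0 ≤ ‖gradient u x‖ ^ (p i - 2) := by positivity
    rw [norm_smul, norm_mul, Real.norm_of_nonneg (hlam.le.trans (hx i).1), Real.norm_of_nonneg hy,
      mul_assoc, ← Real.rpow_add_one' (norm_nonneg _) (by linarith [hp i]),
      show p i - 2 + 1 = p i - 1 by ring]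
    gcongr
    exact (hx i).2
  have hG : LocallyIntegrable β μ := by
    refine (continuous_const (y := B)).locallyIntegrable.mono hβ_meas.aestronglyMeasurable ?_
    filter_upwards [hβ] with x hx
    exact hx.trans (le_abs_self B)
  have hFapp : ∀ (w : E → ℝ) (x : E), fderiv ℝ w x (F x) =
      ∑ i, α i x * ‖gradient u x‖ ^ (p i - 2) * fderiv ℝ w x (gradient u x) := by
    intro w x
    simp only [F, map_sum, map_smul, smul_eq_mul]
  have hintF : ∀ w : E → ℝ, ContDiff ℝ 1 w → HasCompactSupport w →
      Integrable (fun x => fderiv ℝ w x (F x)) μ :=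
    fun w hw hwc => integrable_fderiv_apply hF hw hwc
  have hintG : ∀ w : E → ℝ, ContDiff ℝ 1 w → HasCompactSupport w →
      Integrable (fun x => β x * w x) μ :=
    fun w hw hwc => hG.integrable_smul_right_of_hasCompactSupport hw.continuous hwc
  have hweak : ∀ w : E → ℝ, ContDiff ℝ (⊤ : ℕ∞) w → HasCompactSupport w →
      ∫ x, fderiv ℝ w x (F x) + β x * w x ∂μ = 0 := by
    intro w hw hwc
    have hw' : ContDiff ℝ 1 w := hw.of_le (by exact_mod_cast le_top)
    rw [integral_add (hintF w hw' hwc) (hintG w hw' hwc), ← hsol w hw hwc]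
    congr 2
    ext x
    rw [hFapp]
    simp only [inner_gradient_right, conj_trivial]
  let v : E → ℝ := fun x => u x * η x ^ q
  have hηq : ContDiff ℝ 1 fun x => η x ^ q := hη.pow q
  have hηqc : HasCompactSupport fun x => η x ^ q :=
    hηc.comp_left (g := fun t : ℝ => t ^ q) (zero_pow hq)
  have hv : ContDiff ℝ 1 v := hu.mul hηq
  have hvc : HasCompactSupport v := hηqc.mul_left
  have hzero := integral_fderiv_add_integral_eq_zero_of_contDiff_one hF hG hweak hv hvc
  have hfv : ∀ x, fderiv ℝ v x (gradient u x) = η x ^ q * ‖gradient u x‖ ^ 2 +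
      u x * (q * η x ^ (q - 1) * fderiv ℝ η x (gradient u x)) := by
    intro x
    have h1 : HasFDerivAt u (fderiv ℝ u x) x :=
      (hu.differentiable one_ne_zero x).hasFDerivAt
    have h2 : HasFDerivAt η (fderiv ℝ η x) x :=
      (hη.differentiable one_ne_zero x).hasFDerivAt
    have h3 : HasFDerivAt v _ x := h1.mul (h2.pow q)
    rw [h3.fderiv]
    have h4 : fderiv ℝ u x (gradient u x) = ‖gradient u x‖ ^ 2 := by
      rw [← inner_gradient_left, real_inner_self_eq_norm_sq]
    simp [h4]
    ring
  have hP : ∀ i, Integrable (fun x => ‖gradient u x‖ ^ p i * η x ^ q) μ := fun i =>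
    ((hg.norm.rpow_const fun _ => Or.inr (by linarith [hp i])).mul
      hηq.continuous).integrable_of_hasCompactSupport hηqc.mul_left
  have hQ : ∀ i, Integrable (fun x => (|u x| * ‖fderiv ℝ η x‖) ^ p i) μ := fun i => by
    refine ((hu.continuous.abs.mul hdη.norm).rpow_const fun _ =>
      Or.inr (by linarith [hp i])).integrable_of_hasCompactSupport ?_
    exact ((hηc.fderiv ℝ).norm.mul_left (f := fun x => |u x|)).comp_left
      (g := fun t : ℝ => t ^ p i) (Real.zero_rpow (by linarith [hp i]))
  have hpt : ∀ᵐ x ∂μ, ∑ i, (lam / 2 * (‖gradient u x‖ ^ p i * η x ^ q) -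
      Lam * q * (Lam * q / (lam / 2)) ^ (p i - 1) * (|u x| * ‖fderiv ℝ η x‖) ^ p i) ≤
      fderiv ℝ v x (F x) + β x * v x := by
    filter_upwards [ae_all_iff.2 hα, hβu] with x hx hbx
    have h1 : 0 ≤ β x * v x := by
      rw [← mul_assoc]
      exact mul_nonneg hbx (pow_nonneg (hη0 x) q)
    refine le_add_of_le_of_nonneg ?_ h1
    rw [hFapp]
    refine Finset.sum_le_sum fun i _ => ?_
    rw [hfv]
    exact coercive_sub_le_test_term (hp i) (hpq i) hlam (hx i).1 (hx i).2 _ (hη0 x) (hη1 x) _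
  have hR : ∀ i, Integrable (fun x => lam / 2 * (‖gradient u x‖ ^ p i * η x ^ q) -
      Lam * q * (Lam * q / (lam / 2)) ^ (p i - 1) * (|u x| * ‖fderiv ℝ η x‖) ^ p i) μ :=
    fun i => ((hP i).const_mul _).sub ((hQ i).const_mul _)
  have hS : Integrable (fun x => fderiv ℝ v x (F x) + β x * v x) μ :=
    (hintF v hv hvc).add (hintG v hv hvc)
  have hmono := integral_mono_ae (integrable_finsetSum _ fun i _ => hR i) hS hpt
  rw [hzero, integral_finsetSum _ fun i _ => hR i] at hmono
  simp_rw [integral_sub ((hP _).const_mul _) ((hQ _).const_mul _), integral_const_mul] at hmono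
  rw [Finset.sum_sub_distrib, ← Finset.mul_sum] at hmono
  linarith

/-- Finiteness of the energies under condition (2.16): if a solution `u` of
`-∂_k (∑ i, a i (x, u) |∇u|^(pᵢ-2) ∂_k u) + b (x, u) = 0` in `ℝⁿ` satisfies
`∑ i, r^(-pᵢ) ∫_{B_r \ B_{r/2}} |u|^(pᵢ) ≤ M` for all `r ≥ 1`, then for each `i`
the integrals `∫_{B_r} |∇u|^(pᵢ)` are bounded independently of `r`. -/
theorem energies_finite_under_growth_condition
    (n N : ℕ) (hn : 1 ≤ n) (hN : 1 ≤ N)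
    (p : Fin N → ℝ) (hp_mono : Monotone p) (hp1 : ∀ i, 1 < p i)
    (lam Lam : ℝ) (hlam : 0 < lam) (hLam : lam ≤ Lam)
    (a : Fin N → EuclideanSpace ℝ (Fin n) → ℝ → ℝ)
    (ha_meas : ∀ i s, Measurable fun x => a i x s)
    (ha_cont : ∀ i (x : EuclideanSpace ℝ (Fin n)), Continuous fun s => a i x s)
    (ha_bnd : ∀ i, ∀ᵐ x ∂(volume : Measure (EuclideanSpace ℝ (Fin n))),
      ∀ s : ℝ, lam ≤ a i x s ∧ a i x s ≤ Lam)
    (b : EuclideanSpace ℝ (Fin n) → ℝ → ℝ)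
    (hb_meas : ∀ s, Measurable fun x => b x s)
    (hb_cont : ∀ x : EuclideanSpace ℝ (Fin n), Continuous fun s => b x s)
    (B : ℝ)
    (hb_bnd : ∀ᵐ x ∂(volume : Measure (EuclideanSpace ℝ (Fin n))), ∀ s : ℝ, |b x s| ≤ B)
    (hb_sign : ∀ᵐ x ∂(volume : Measure (EuclideanSpace ℝ (Fin n))), ∀ s : ℝ, 0 ≤ b x s * s)
    (u : EuclideanSpace ℝ (Fin n) → ℝ) (hu : ContDiff ℝ 1 u)
    (M : ℝ) (hM : 0 < M)
    (hu_growth : ∀ r : ℝ, 1 ≤ r →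
      ∑ i, r ^ (-(p i)) * ∫ x in ball (0 : EuclideanSpace ℝ (Fin n)) r \ ball 0 (r / 2),
        |u x| ^ (p i) ≤ M)
    (hu_sol : ∀ v : EuclideanSpace ℝ (Fin n) → ℝ, ContDiff ℝ (⊤ : ℕ∞) v →
      HasCompactSupport v →
      (∫ x, ∑ i, a i x (u x) * ‖gradient u x‖ ^ (p i - 2) * ⟪gradient u x, gradient v x⟫) +
      (∫ x, b x (u x) * v x) = 0) :
    ∀ i, ∃ C : ℝ, ∀ r : ℝ, 0 < r →
      ∫ x in ball (0 : EuclideanSpace ℝ (Fin n)) r, ‖gradient u x‖ ^ (p i) ≤ C := by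
  obtain ⟨c, hc, hcut⟩ := exists_cutoff_ball (EuclideanSpace ℝ (Fin n))
  obtain ⟨q, hq⟩ := exists_nat_ge (∑ i, p i)
  have hp0 : ∀ i, 0 < p i := fun i => zero_lt_one.trans (hp1 i)
  have hpq : ∀ i, p i ≤ q := fun i =>
    (Finset.single_le_sum (fun j _ => (hp0 j).le) (Finset.mem_univ i)).trans hq
  have hLam0 : 0 ≤ Lam := hlam.le.trans hLam
  have hg := hu.continuous_gradient
  let D : Fin N → ℝ := fun i => Lam * q * (Lam * q / (lam / 2)) ^ (p i - 1)
  have hD : ∀ i, 0 ≤ D i := fun i => by positivity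
  intro i
  have hq0 : q ≠ 0 := fun h => by
    have := hpq i
    rw [h, Nat.cast_zero] at this
    linarith [hp0 i]
  refine ⟨(∑ j, D j * (c ^ p j * M)) / (lam / 2), fun r hr => ?_⟩
  let R := max (2 * r) 1
  have hR1 : 1 ≤ R := le_max_right _ _
  have hR : 0 < R := by positivity
  have hrR : r ≤ R / 2 := by linarith [le_max_left (2 * r) 1]
  obtain ⟨η, hη, hηc, hη0, hη1, hηone, hηd, hηd0⟩ := hcut R hR
  have hcac := caccioppoli_of_weak_solution (μ := volume) hp1 hpq hq0 hlam
    (fun i => measurable_caratheodory_comp (ha_meas i) (ha_cont i) hu.continuous)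
    (fun i => (ha_bnd i).mono fun x hx => hx (u x))
    (measurable_caratheodory_comp hb_meas hb_cont hu.continuous)
    (hb_bnd.mono fun x hx => hx (u x)) (hb_sign.mono fun x hx => hx (u x)) hu hu_sol
    hη hηc hη0 hη1
  have hgp : ∀ j, Continuous fun x => ‖gradient u x‖ ^ p j := fun j =>
    hg.norm.rpow_const fun _ => Or.inr (hp0 j).le
  have hPint : ∀ j, Integrable fun x => ‖gradient u x‖ ^ p j * η x ^ q := fun j =>
    ((hgp j).mul (hη.continuous.pow q)).integrable_of_hasCompactSupport
      (hηc.comp_left (g := fun t : ℝ => t ^ q) (zero_pow hq0)).mul_left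
  have hPnn : ∀ j x, 0 ≤ ‖gradient u x‖ ^ p j * η x ^ q := fun j x =>
    mul_nonneg (by positivity) (pow_nonneg (hη0 x) q)
  have hlower : ∫ x in ball (0 : EuclideanSpace ℝ (Fin n)) r, ‖gradient u x‖ ^ p i ≤
      ∑ j, ∫ x, ‖gradient u x‖ ^ p j * η x ^ q := by
    calc _ = ∫ x in ball (0 : EuclideanSpace ℝ (Fin n)) r, ‖gradient u x‖ ^ p i * η x ^ q := by
          refine setIntegral_congr_fun measurableSet_ball fun x hx => ?_
          simp [hηone x (ball_subset_ball hrR hx)]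
      _ ≤ ∫ x, ‖gradient u x‖ ^ p i * η x ^ q :=
        setIntegral_le_integral (hPint i) (Filter.Eventually.of_forall (hPnn i))
      _ ≤ _ := Finset.single_le_sum (f := fun j => ∫ x, ‖gradient u x‖ ^ p j * η x ^ q)
        (fun j _ => integral_nonneg (hPnn j)) (Finset.mem_univ i)
  have hupper : ∀ j, ∫ x, (|u x| * ‖fderiv ℝ η x‖) ^ p j ≤ c ^ p j * M := by
    intro j
    let A := ball (0 : EuclideanSpace ℝ (Fin n)) R \ ball 0 (R / 2)
    have hA : MeasurableSet A := measurableSet_ball.diff measurableSet_ball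
    have hup : Continuous fun x => |u x| ^ p j :=
      hu.continuous.abs.rpow_const fun _ => Or.inr (hp0 j).le
    have huA : IntegrableOn (fun x => |u x| ^ p j) A :=
      (hup.locallyIntegrable.integrableOn_isCompact (isCompact_closedBall 0 R)).mono_set
        (Set.sdiff_subset.trans ball_subset_closedBall)
    have hterm : R ^ (-(p j)) * ∫ x in A, |u x| ^ p j ≤ M :=
      (Finset.single_le_sum (f := fun k => R ^ (-(p k)) * ∫ x in A, |u x| ^ p k)
        (fun k _ => mul_nonneg (by positivity) (integral_nonneg fun x => by positivity))
        (Finset.mem_univ j)).trans (hu_growth R hR1)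
    calc _ = ∫ x in A, (|u x| * ‖fderiv ℝ η x‖) ^ p j := by
          refine (setIntegral_eq_integral_of_forall_compl_eq_zero fun x hx => ?_).symm
          rw [hηd0 x hx, norm_zero, mul_zero, Real.zero_rpow (hp0 j).ne']
      _ ≤ ∫ x in A, (c * R⁻¹) ^ p j * |u x| ^ p j := by
          refine integral_mono_of_nonneg (Filter.Eventually.of_forall fun x => by positivity)
            (huA.const_mul _) (Filter.Eventually.of_forall fun x => ?_)
          change (|u x| * ‖fderiv ℝ η x‖) ^ p j ≤ (c * R⁻¹) ^ p j * |u x| ^ p j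
          rw [← Real.mul_rpow (by positivity) (abs_nonneg _), mul_comm]
          exact Real.rpow_le_rpow (by positivity) (by gcongr; exact hηd x) (hp0 j).le
      _ = c ^ p j * (R ^ (-(p j)) * ∫ x in A, |u x| ^ p j) := by
          rw [integral_const_mul, Real.mul_rpow hc (by positivity), Real.inv_rpow hR.le,
            Real.rpow_neg hR.le, mul_assoc]
      _ ≤ c ^ p j * M := by gcongr
  rw [le_div_iff₀' (by positivity)]
  calc _ ≤ lam / 2 * ∑ j, ∫ x, ‖gradient u x‖ ^ p j * η x ^ q := by gcongr
    _ ≤ ∑ j, D j * ∫ x, (|u x| * ‖fderiv ℝ η x‖) ^ p j := hcac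
    _ ≤ _ := Finset.sum_le_sum fun j _ => mul_le_mul_of_nonneg_left (hupper j) (hD j)
end

section
/- Abstract dyadic iteration lemma: let F : (0,∞) → ℝ be nonnegative and nondecreasing, and suppose there are constants δ > 0, C > 0, C' > 0, m ∈ ℝ and r₀ ≥ 1 such that F(r/2) ≤ C r^{−δ} F(r) for every r ≥ r₀ and F(r) ≤ C' r^m for every r ≥ r₀. Then F(s) = 0 for every s > 0. -/
/-- The decay inequality `F (r / 2) ≤ C r^(-δ) F r` improves a polynomial bound of exponent `m`
to one of exponent `m - n δ`, for every `n`. -/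
theorem exists_rpow_bound_of_dyadic_decay {F : ℝ → ℝ} {δ C C' m r₀ : ℝ} (hC : 0 ≤ C)
    (hr₀ : 0 < r₀) (h_decay : ∀ r : ℝ, r₀ ≤ r → F (r / 2) ≤ C * r ^ (-δ) * F r)
    (h_growth : ∀ r : ℝ, r₀ ≤ r → F r ≤ C' * r ^ m) (n : ℕ) :
    ∃ K : ℝ, ∀ r : ℝ, r₀ ≤ r → F r ≤ K * r ^ (m - n * δ) := by
  induction n with
  | zero => exact ⟨C', by simpa using h_growth⟩
  | succ n ih =>
    obtain ⟨K, hK⟩ := ih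
    refine ⟨C * K * 2 ^ (m - (n + 1 : ℕ) * δ), fun r hr => ?_⟩
    have hr_pos : 0 < r := hr₀.trans_le hr
    have h2r : r₀ ≤ 2 * r := by linarith
    calc F r = F (2 * r / 2) := by rw [mul_div_cancel_left₀ r two_ne_zero]
      _ ≤ C * (2 * r) ^ (-δ) * F (2 * r) := h_decay _ h2r
      _ ≤ C * (2 * r) ^ (-δ) * (K * (2 * r) ^ (m - n * δ)) := by
        gcongr
        exact hK _ h2r
      _ = C * K * (2 * r) ^ (-δ + (m - n * δ)) := by
        rw [Real.rpow_add (by positivity)]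
        ring
      _ = C * K * 2 ^ (m - (n + 1 : ℕ) * δ) * r ^ (m - (n + 1 : ℕ) * δ) := by
        rw [mul_assoc (C * K), ← Real.mul_rpow zero_le_two hr_pos.le]
        congr 2
        push_cast
        ring

/-- Abstract dyadic iteration lemma: if `F` is nonnegative and nondecreasing on `(0, ∞)`,
satisfies `F (r/2) ≤ C r^(-δ) F r` for `r ≥ r₀` and `F r ≤ C' r^m` for `r ≥ r₀`,
then `F` vanishes identically on `(0, ∞)`. -/
theorem abstract_dyadic_iteration
    (F : ℝ → ℝ)
    (hF_nonneg : ∀ r : ℝ, 0 < r → 0 ≤ F r)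
    (hF_mono : ∀ r s : ℝ, 0 < r → r ≤ s → F r ≤ F s)
    (δ C C' : ℝ) (hδ : 0 < δ) (hC : 0 < C) (hC' : 0 < C') (m : ℝ)
    (r₀ : ℝ) (hr₀ : 1 ≤ r₀)
    (h_decay : ∀ r : ℝ, r₀ ≤ r → F (r / 2) ≤ C * r ^ (-δ) * F r)
    (h_growth : ∀ r : ℝ, r₀ ≤ r → F r ≤ C' * r ^ m) :
    ∀ s : ℝ, 0 < s → F s = 0 := by
  intro s hs
  obtain ⟨n, hn⟩ := exists_nat_gt (m / δ)
  obtain ⟨K, hK⟩ := exists_rpow_bound_of_dyadic_decay hC.le (by linarith) h_decay h_growth n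
  have h_exp : 0 < n * δ - m := sub_pos.2 ((div_lt_iff₀ hδ).1 hn)
  have h_lim : Filter.Tendsto (fun r : ℝ => K * r ^ (m - n * δ)) Filter.atTop (nhds 0) := by
    simpa using (tendsto_rpow_neg_atTop h_exp).const_mul K
  refine le_antisymm (ge_of_tendsto h_lim ?_) (hF_nonneg s hs)
  filter_upwards [Filter.eventually_ge_atTop s, Filter.eventually_ge_atTop r₀] with r hsr hr
  exact (hF_mono s r hs hsr).trans (hK r hr)
end

section
/- Existence of a nontrivial bounded solution when p < n (Theorem 4.3): let n ≥ 2 and 1 < p < n. Then there exist r₀ > 0, a bounded measurable function b : ℝⁿ → ℝ with b ≥ 0, b radially symmetric (b(x) depends only on |x|), b not a.e. equal to 0, and b(x) = 0 for all |x| ≥ r₀, and a function u : ℝⁿ → ℝ which is continuous on ℝⁿ and C¹ on ℝⁿ \ {0}, satisfies 0 ≤ u ≤ 1 on ℝⁿ, is not identically zero, and is a weak solution of -Δ_p u + b|u|^{p−2}u = 0 on ℝⁿ, i.e. ∫_{ℝⁿ} |∇u|^{p−2} ∇u·∇v dx + ∫_{ℝⁿ} b |u|^{p−2} u v dx = 0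 for every smooth compactly supported v : ℝⁿ → ℝ. -/
open MeasureTheory Metric
open scoped RealInnerProductSpace

section Polar

open Set Filter Topology Module

variable {E : Type*} [NormedAddCommGroup E] [NormedSpace ℝ E]
  [MeasurableSpace E] [BorelSpace E] (μ : Measure E) [μ.IsAddHaarMeasure]

/-- Integration in polar coordinates. -/
theorem integral_eq_integral_sphere_integral_Ioi [FiniteDimensional ℝ E] [Nontrivial E]
    {f : E → ℝ} (hf : Integrable f μ) :
    ∫ x, f x ∂μ = ∫ ω : sphere (0 : E) 1, (∫ r in Ioi (0 : ℝ),
      r ^ (finrank ℝ E - 1) * f (r • (ω : E))) ∂μ.toSphere := by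
  have hmp := μ.measurePreserving_homeomorphUnitSphereProd
  have hemb := (homeomorphUnitSphereProd E).measurableEmbedding
  set g : sphere (0 : E) 1 × Ioi (0 : ℝ) → ℝ := fun y => f ((y.2 : ℝ) • (y.1 : E)) with hg
  have hgf : ∀ x : ({0}ᶜ : Set E), g (homeomorphUnitSphereProd E x) = f x := by
    intro x
    have := congrArg Subtype.val ((homeomorphUnitSphereProd E).symm_apply_apply x)
    rw [homeomorphUnitSphereProd_symm_apply_coe] at this
    simp only [hg, this]
  have hms : MeasurableSet ({0}ᶜ : Set E) := (measurableSet_singleton _).compl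
  have hint : Integrable g (μ.toSphere.prod (.volumeIoiPow (finrank ℝ E - 1))) := by
    rw [← hmp.integrable_comp_emb hemb]
    have h : IntegrableOn f ({0}ᶜ : Set E) μ := hf.integrableOn
    rw [integrableOn_iff_comap_subtypeVal hms] at h
    exact h.congr (.of_forall fun x => (hgf x).symm)
  calc
    ∫ x, f x ∂μ = ∫ x : ({0}ᶜ : Set E), g (homeomorphUnitSphereProd E x) ∂(μ.comap (↑)) := by
      simp only [hgf]
      rw [integral_subtype_comap hms, restrict_compl_singleton]
    _ = ∫ y, g y ∂μ.toSphere.prod (.volumeIoiPow (finrank ℝ E - 1)) := hmp.integral_comp hemb g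
    _ = ∫ ω, ∫ r, g (ω, r) ∂(.volumeIoiPow (finrank ℝ E - 1)) ∂μ.toSphere :=
      integral_prod _ hint
    _ = _ := by
      refine integral_congr_ae (.of_forall fun ω => ?_)
      simp only [Measure.volumeIoiPow, ENNReal.ofReal, hg]
      rw [integral_withDensity_eq_integral_smul,
        integral_subtype_comap measurableSet_Ioi
          fun a : ℝ => Real.toNNReal (a ^ (finrank ℝ E - 1)) • f (a • (ω : E)),
        setIntegral_congr_fun measurableSet_Ioi fun x hx => ?_]
      · rw [NNReal.smul_def, Real.coe_toNNReal _ (pow_nonneg hx.out.le _), smul_eq_mul]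
      · exact (measurable_subtype_coe.pow_const _).real_toNNReal

/-- One-dimensional form, along a ray, of the divergence theorem for the truncated radial field. -/
theorem integral_Ioi_radial_flux_eq_zero {d : ℕ} (hd : d ≠ 0) {φ : ℝ → ℝ} (hφ : ContDiff ℝ 1 φ)
    (hc : HasCompactSupport φ) :
    ∫ r in Ioi (0 : ℝ), r ^ (d - 1) * ((max 1 r ^ d)⁻¹ * (r * deriv φ r) +
      d * (Iic (1 : ℝ)).indicator φ r) = 0 := by
  have hφ' : Continuous (deriv φ) := hφ.continuous_deriv le_rfl
  have hpow : ∀ r : ℝ, r ^ d = r ^ (d - 1) * r := fun r => (pow_sub_one_mul hd r).symm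
  have hinner : EqOn (fun r => r ^ (d - 1) * ((max 1 r ^ d)⁻¹ * (r * deriv φ r) +
      d * (Iic (1 : ℝ)).indicator φ r)) (fun r => d * r ^ (d - 1) * φ r + r ^ d * deriv φ r)
      (Ioc 0 1) := by
    intro r hr
    simp only [max_eq_left hr.2, indicator_of_mem (mem_Iic.2 hr.2), hpow r]
    simp
    ring
  have houter : EqOn (fun r => r ^ (d - 1) * ((max 1 r ^ d)⁻¹ * (r * deriv φ r) +
      d * (Iic (1 : ℝ)).indicator φ r)) (deriv φ) (Ioi 1) := by
    intro r hr
    have hr' : (1 : ℝ) < r := hr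
    have h0 : r ≠ 0 := by positivity
    simp only [max_eq_right hr'.le, indicator_of_notMem (notMem_Iic.2 hr'), hpow r]
    field_simp
    simp
  have hcont : Continuous fun r => d * r ^ (d - 1) * φ r + r ^ d * deriv φ r := by
    have := hφ.continuous
    fun_prop
  rw [← Ioc_union_Ioi_eq_Ioi zero_le_one, setIntegral_union Ioc_disjoint_Ioi_same
    measurableSet_Ioi, setIntegral_congr_fun measurableSet_Ioc hinner,
    setIntegral_congr_fun measurableSet_Ioi houter, hc.integral_Ioi_deriv_eq hφ,
    ← intervalIntegral.integral_of_le zero_le_one,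
    intervalIntegral.integral_eq_sub_of_hasDerivAt (f := fun r => r ^ d * φ r)]
  · simp [hd]
  · intro r _
    exact (hasDerivAt_pow d r).mul (hφ.differentiable one_ne_zero r).hasDerivAt
  · exact hcont.intervalIntegrable _ _
  · exact (hcont.integrableOn_Icc.mono_set Ioc_subset_Icc_self).congr_fun hinner.symm
      measurableSet_Ioc
  · exact ((hφ'.integrable_of_hasCompactSupport hc.deriv).integrableOn).congr_fun houter.symm
      measurableSet_Ioi

theorem integrable_radial_flux {v : E → ℝ} (hv : ContDiff ℝ 1 v) (hc : HasCompactSupport v)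
    (d : ℕ) : Integrable (fun x => (max 1 ‖x‖ ^ d)⁻¹ * fderiv ℝ v x x) μ := by
  have hv' := hv.continuous_fderiv one_ne_zero
  refine Continuous.integrable_of_hasCompactSupport ?_ ?_
  · refine Continuous.mul (Continuous.inv₀ (by fun_prop) fun x => ?_) (hv'.clm_apply continuous_id)
    have : 0 < max 1 ‖x‖ := lt_max_of_lt_left one_pos
    positivity
  · refine (hc.fderiv ℝ).mono' ?_
    refine fun x hx => subset_tsupport _ ?_
    contrapose! hx
    rw [Function.notMem_support] at hx ⊢
    simp [hx]

theorem integrable_indicator_closedBall [FiniteDimensional ℝ E] {v : E → ℝ}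
    (hv : Continuous v) (c : ℝ) :
    Integrable ((closedBall (0 : E) 1).indicator fun x => c * v x) μ :=
  (integrable_indicator_iff measurableSet_closedBall).2
    ((hv.const_mul c).continuousOn.integrableOn_compact (isCompact_closedBall 0 1))

/-- The field `max 1 ‖x‖ ^ (-d) • x`, with `d` the dimension, has distributional divergence
`d` times the indicator of the unit ball. -/
theorem integral_radial_flux_add_eq_zero [FiniteDimensional ℝ E] [Nontrivial E] {v : E → ℝ}
    (hv : ContDiff ℝ 1 v) (hc : HasCompactSupport v) :
    (∫ x, (max 1 ‖x‖ ^ finrank ℝ E)⁻¹ * fderiv ℝ v x x ∂μ) +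
      ∫ x, (closedBall (0 : E) 1).indicator (fun x => finrank ℝ E * v x) x ∂μ = 0 := by
  have h1 := integrable_radial_flux μ hv hc (finrank ℝ E)
  have h2 := integrable_indicator_closedBall μ hv.continuous (finrank ℝ E)
  refine (integral_add h1 h2).symm.trans
    ((integral_eq_integral_sphere_integral_Ioi μ (h1.add h2)).trans ?_)
  refine integral_eq_zero_of_ae (.of_forall fun ω => ?_)
  have hω : ‖(ω : E)‖ = 1 := norm_eq_of_mem_sphere ω
  have hω0 : (ω : E) ≠ 0 := ne_zero_of_mem_unit_sphere ω
  set φ : ℝ → ℝ := fun r => v (r • (ω : E))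
  have hφ : ContDiff ℝ 1 φ := hv.comp (contDiff_id.smul contDiff_const)
  have hφc : HasCompactSupport φ :=
    hc.comp_isClosedEmbedding (isClosedEmbedding_smul_left hω0)
  have hφ' : ∀ r, deriv φ r = fderiv ℝ v (r • (ω : E)) ω := fun r =>
    (((hv.differentiable one_ne_zero _).hasFDerivAt).comp_hasDerivAt r
      ((hasDerivAt_id r).smul_const (ω : E))).deriv.trans (by simp)
  refine Eq.trans (setIntegral_congr_fun measurableSet_Ioi fun r hr => ?_)
    (integral_Ioi_radial_flux_eq_zero (finrank_pos (R := ℝ) (M := E)).ne' hφ hφc)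
  have hr0 : (0 : ℝ) < r := hr
  have hnorm : ‖r • (ω : E)‖ = r := by rw [norm_smul, hω, mul_one, Real.norm_of_nonneg hr0.le]
  rw [hφ']
  by_cases hr1 : r ≤ 1 <;> simp [hnorm, indicator, hr1, φ]

end Polar

section Profile

open Set Filter Topology

/-- The derivative, up to a constant factor, of the radial profile of the solution. -/
noncomputable def profileDeriv (n : ℕ) (q r : ℝ) : ℝ := (r / max 1 r ^ n) ^ q

theorem continuous_profileDeriv (n : ℕ) {q : ℝ} (hq : 0 ≤ q) :
    Continuous (profileDeriv n q) := by
  refine Continuous.rpow_const (Continuous.div continuous_id (by fun_prop) fun r => ?_)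
    fun _ => Or.inr hq
  have : 0 < max 1 r := lt_max_of_lt_left one_pos
  positivity

theorem profileDeriv_pos (n : ℕ) (q : ℝ) {r : ℝ} (hr : 0 < r) : 0 < profileDeriv n q r :=
  Real.rpow_pos_of_pos (div_pos hr (pow_pos (lt_max_of_lt_left one_pos) n)) q

theorem profileDeriv_nonneg (n : ℕ) (q : ℝ) {r : ℝ} (hr : 0 ≤ r) : 0 ≤ profileDeriv n q r :=
  Real.rpow_nonneg (div_nonneg hr (pow_nonneg (le_max_of_le_left zero_le_one) n)) q

theorem profileDeriv_rpow {n : ℕ} {q s : ℝ} (hqs : q * s = 1) {r : ℝ} (hr : 0 ≤ r) :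
    profileDeriv n q r ^ s = r / max 1 r ^ n := by
  rw [profileDeriv, ← Real.rpow_mul (div_nonneg hr (pow_nonneg (le_max_of_le_left zero_le_one) n)),
    hqs, Real.rpow_one]

theorem integrableOn_profileDeriv {n : ℕ} {q : ℝ} (hq : 0 ≤ q) (hnq : 1 < (n - 1) * q) :
    IntegrableOn (profileDeriv n q) (Ioi 0) := by
  rw [← Ioc_union_Ioi_eq_Ioi zero_le_one]
  refine IntegrableOn.union ?_ ?_
  · exact ((continuous_profileDeriv n hq).integrableOn_Icc).mono_set Ioc_subset_Icc_self
  · refine (integrableOn_Ioi_rpow_of_lt (a := (1 - n) * q) (by linarith) one_pos).congr_fun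
      (fun r hr => ?_) measurableSet_Ioi
    have hr1 : (1 : ℝ) < r := hr
    have hr0 : 0 < r := by positivity
    beta_reduce
    rw [profileDeriv, max_eq_right hr1.le, Real.rpow_mul hr0.le, Real.rpow_sub hr0, Real.rpow_one,
      Real.rpow_natCast]

/-- The radial profile of the solution. -/
noncomputable def profile (n : ℕ) (q k r : ℝ) : ℝ :=
  1 / 2 + k * ∫ t in (0 : ℝ)..r, profileDeriv n q t

theorem hasDerivAt_profile (n : ℕ) {q : ℝ} (hq : 0 ≤ q) (k r : ℝ) :
    HasDerivAt (profile n q k) (k * profileDeriv n q r) r :=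
  ((((continuous_profileDeriv n hq).integral_hasStrictDerivAt 0 r).hasDerivAt).const_mul
    k).const_add (1 / 2)

theorem contDiff_profile (n : ℕ) {q : ℝ} (hq : 0 ≤ q) (k : ℝ) : ContDiff ℝ 1 (profile n q k) := by
  refine contDiff_one_iff_deriv.2
    ⟨fun r => (hasDerivAt_profile n hq k r).differentiableAt, ?_⟩
  rw [funext fun r => (hasDerivAt_profile n hq k r).deriv]
  exact (continuous_profileDeriv n hq).const_mul k

theorem half_le_profile (n : ℕ) (q : ℝ) {k r : ℝ} (hk : 0 ≤ k) (hr : 0 ≤ r) :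
    1 / 2 ≤ profile n q k r :=
  le_add_of_nonneg_right <| mul_nonneg hk <|
    intervalIntegral.integral_nonneg hr fun _ ht => profileDeriv_nonneg n q ht.1

theorem exists_profile_le_one {n : ℕ} {q : ℝ} (hq : 0 ≤ q) (hnq : 1 < (n - 1) * q) :
    ∃ k : ℝ, 0 < k ∧ ∀ r, 0 ≤ r → profile n q k r ≤ 1 := by
  have hint := integrableOn_profileDeriv hq hnq
  have hnn : 0 ≤ᵐ[volume.restrict (Ioi 0)] profileDeriv n q :=
    (ae_restrict_mem measurableSet_Ioi).mono fun t ht => profileDeriv_nonneg n q (le_of_lt ht)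
  set I := ∫ t in Ioi 0, profileDeriv n q t
  have hI0 : 0 ≤ I := integral_nonneg_of_ae hnn
  refine ⟨1 / (2 * (I + 1)), by positivity, fun r hr => ?_⟩
  have hle : ∫ t in (0 : ℝ)..r, profileDeriv n q t ≤ I := by
    rw [intervalIntegral.integral_of_le hr]
    exact setIntegral_mono_set hint hnn Ioc_subset_Ioi_self.eventuallyLE
  have : 1 / (2 * (I + 1)) * (∫ t in (0 : ℝ)..r, profileDeriv n q t) ≤ 1 / 2 := by
    rw [div_mul_eq_mul_div, div_le_div_iff₀ (by positivity) two_pos]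
    linarith
  rw [profile]
  linarith

end Profile

section Gradient

variable {E : Type*} [NormedAddCommGroup E] [InnerProductSpace ℝ E]

theorem hasFDerivAt_norm_of_ne_zero {x : E} (hx : x ≠ 0) :
    HasFDerivAt (fun y : E => ‖y‖) (‖x‖⁻¹ • innerSL ℝ x) x := by
  have h := (hasStrictFDerivAt_norm_sq x).hasFDerivAt.sqrt (pow_ne_zero 2 (norm_ne_zero_iff.2 hx))
  simp only [Real.sqrt_sq (norm_nonneg _)] at h
  convert! h using 1
  ext y
  simp
  field_simp

theorem HasDerivAt.hasGradientAt_comp_norm [CompleteSpace E] {U : ℝ → ℝ} {c : ℝ} {x : E}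
    (hx : x ≠ 0) (hU : HasDerivAt U c ‖x‖) :
    HasGradientAt (fun y => U ‖y‖) ((c / ‖x‖) • x) x := by
  rw [hasGradientAt_iff_hasFDerivAt]
  convert! hU.comp_hasFDerivAt x (hasFDerivAt_norm_of_ne_zero hx) using 1
  ext y
  simp
  ring

/-- The p-Laplacian flux of a radial function. -/
theorem rpow_norm_gradient_comp_norm_mul_inner [CompleteSpace E] {U : ℝ → ℝ} {c p : ℝ} {x : E}
    (hx : x ≠ 0) (hc : 0 < c) (hU : HasDerivAt U c ‖x‖) (v : E → ℝ) :
    ‖gradient (fun y => U ‖y‖) x‖ ^ (p - 2) * ⟪gradient (fun y => U ‖y‖) x, gradient v x⟫ =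
      c ^ (p - 1) / ‖x‖ * fderiv ℝ v x x := by
  have hx0 : ‖x‖ ≠ 0 := norm_ne_zero_iff.2 hx
  rw [(hU.hasGradientAt_comp_norm hx).gradient, norm_smul, norm_div, norm_norm,
    div_mul_cancel₀ _ hx0, Real.norm_of_nonneg hc.le, real_inner_smul_left, inner_gradient_right,
    show p - 1 = p - 2 + 1 by ring, Real.rpow_add_one hc.ne']
  simp
  ring

end Gradient

/-- Existence of a nontrivial bounded solution when `p < n` (Theorem 4.3): for `1 < p < n`
there exist a nonnegative, bounded, radially symmetric, compactly supported potential `b`,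
not a.e. zero, and a nontrivial weak solution `0 ≤ u ≤ 1` of `-Δ_p u + b |u|^(p-2) u = 0`
on `ℝⁿ`, continuous on `ℝⁿ` and `C¹` away from the origin. -/
theorem exists_nontrivial_bounded_solution
    (n : ℕ) (hn : 2 ≤ n) (p : ℝ) (hp1 : 1 < p) (hpn : p < n) :
    ∃ (r₀ : ℝ) (b u : EuclideanSpace ℝ (Fin n) → ℝ),
      0 < r₀ ∧
      Measurable b ∧
      (∃ B : ℝ, ∀ x, |b x| ≤ B) ∧
      (∀ x, 0 ≤ b x) ∧
      (∀ x y : EuclideanSpace ℝ (Fin n), ‖x‖ = ‖y‖ → b x = b y) ∧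
      ¬ (∀ᵐ x ∂(volume : Measure (EuclideanSpace ℝ (Fin n))), b x = 0) ∧
      (∀ x : EuclideanSpace ℝ (Fin n), r₀ ≤ ‖x‖ → b x = 0) ∧
      Continuous u ∧
      ContDiffOn ℝ 1 u {(0 : EuclideanSpace ℝ (Fin n))}ᶜ ∧
      (∀ x, 0 ≤ u x ∧ u x ≤ 1) ∧
      ¬ (∀ x, u x = 0) ∧
      (∀ v : EuclideanSpace ℝ (Fin n) → ℝ, ContDiff ℝ (⊤ : ℕ∞) v →
        HasCompactSupport v →
        (∫ x, ‖gradient u x‖ ^ (p - 2) * ⟪gradient u x, gradient v x⟫) +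
        (∫ x, b x * |u x| ^ (p - 2) * u x * v x) = 0) := by
  have hp0 : 0 < p - 1 := sub_pos.2 hp1
  set q : ℝ := (p - 1)⁻¹
  have hq : 0 ≤ q := (inv_pos.2 hp0).le
  have hqp : q * (p - 1) = 1 := inv_mul_cancel₀ hp0.ne'
  have hnq : 1 < (n - 1) * q := by
    rw [← div_eq_mul_inv, one_lt_div hp0]
    linarith
  obtain ⟨k, hk, hk1⟩ := exists_profile_le_one hq hnq
  have : NeZero n := ⟨by omega⟩
  set u : EuclideanSpace ℝ (Fin n) → ℝ := fun x => profile n q k ‖x‖ with hu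
  have hu2 : ∀ x, 1 / 2 ≤ u x := fun x => half_le_profile n q hk.le (norm_nonneg x)
  have hu0 : ∀ x, 0 < u x := fun x => by linarith [hu2 x]
  have huc : Continuous u := (contDiff_profile n hq k).continuous.comp continuous_norm
  set C : ℝ := k ^ (p - 1)
  have hC0 : 0 < C := Real.rpow_pos_of_pos hk _
  have hn0 : (0 : ℝ) < n := by positivity
  set w : EuclideanSpace ℝ (Fin n) → ℝ := fun x => n * C / u x ^ (p - 1) with hw
  have hw0 : ∀ x, 0 < w x := fun x => div_pos (mul_pos hn0 hC0) (Real.rpow_pos_of_pos (hu0 x) _)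
  have hwB : ∀ x, w x ≤ n * C / (1 / 2) ^ (p - 1) := fun x => by
    have := hu2 x
    simp only [hw]
    gcongr
  have hwc : Continuous w :=
    continuous_const.div (huc.rpow_const fun x => Or.inl (hu0 x).ne')
      fun x => (Real.rpow_pos_of_pos (hu0 x) _).ne'
  refine ⟨2, (closedBall 0 1).indicator w, u, two_pos,
    hwc.measurable.indicator measurableSet_closedBall,
    ⟨n * C / (1 / 2) ^ (p - 1), fun x => ?_⟩,
    fun x => Set.indicator_nonneg (fun x _ => (hw0 x).le) x, fun x y hxy => ?_, fun h => ?_,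
    fun x hx => Set.indicator_of_notMem ?_ w, huc, ?_, fun x => ⟨(hu0 x).le, hk1 _ (norm_nonneg x)⟩,
    fun h => (hu0 0).ne' (h 0), fun v hv hvc => ?_⟩
  · rw [abs_of_nonneg (Set.indicator_nonneg (fun x _ => (hw0 x).le) x)]
    exact (Set.indicator_le_self' (fun _ _ => (hw0 _).le) x).trans (hwB x)
  · simp [Set.indicator, hw, hu, hxy]
  · have hball : ball (0 : EuclideanSpace ℝ (Fin n)) 1 ⊆
        {x | ¬ (closedBall 0 1).indicator w x = 0} := fun x hx => by
      rw [Set.mem_ofPred_eq, Set.indicator_of_mem (ball_subset_closedBall hx)]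
      exact (hw0 x).ne'
    exact (measure_ball_pos volume (0 : EuclideanSpace ℝ (Fin n)) one_pos).ne'
      (measure_mono_null hball h)
  · rw [mem_closedBall_zero_iff]
    linarith
  · exact (contDiff_profile n hq k).comp_contDiffOn
      (contDiffOn_id.norm ℝ fun x hx => hx)
  · have hv1 : ContDiff ℝ 1 v := hv.of_le (by exact_mod_cast le_top)
    have hflux : ∀ᵐ x : EuclideanSpace ℝ (Fin n), ‖gradient u x‖ ^ (p - 2) *
        ⟪gradient u x, gradient v x⟫ = C * ((max 1 ‖x‖ ^ n)⁻¹ * fderiv ℝ v x x) := by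
      filter_upwards [Measure.ae_ne volume (0 : EuclideanSpace ℝ (Fin n))] with x hx
      have hx0 : 0 < ‖x‖ := norm_pos_iff.2 hx
      have hd := profileDeriv_pos n q hx0
      rw [rpow_norm_gradient_comp_norm_mul_inner hx (mul_pos hk hd) (hasDerivAt_profile n hq k _),
        Real.mul_rpow hk.le hd.le, profileDeriv_rpow hqp hx0.le]
      field_simp
      exact mul_comm _ _
    have hpot : ∀ x, (closedBall 0 1).indicator w x * |u x| ^ (p - 2) * u x * v x =
        C * (closedBall 0 1).indicator (fun x => n * v x) x := fun x => by
      by_cases hx : x ∈ closedBall (0 : EuclideanSpace ℝ (Fin n)) 1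
      · have hpow : u x ^ (p - 1) = u x ^ (p - 2) * u x := by
          rw [← Real.rpow_add_one (hu0 x).ne']
          ring_nf
        have hpos : 0 < u x ^ (p - 2) := Real.rpow_pos_of_pos (hu0 x) _
        have := hu0 x
        rw [Set.indicator_of_mem hx, Set.indicator_of_mem hx, abs_of_pos (hu0 x)]
        simp only [hw, hpow]
        field_simp
      · simp [Set.indicator_of_notMem hx]
    have hdiv := integral_radial_flux_add_eq_zero
      (volume : Measure (EuclideanSpace ℝ (Fin n))) hv1 hvc
    rw [finrank_euclideanSpace_fin] at hdiv
    rw [integral_congr_ae hflux, integral_congr_ae (.of_forall hpot), integral_const_mul,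
      integral_const_mul, ← mul_add, hdiv, mul_zero]
end
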